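/- Let ℓ ≥ −1/2, 0 ≤ μ < 1/2 and x > 0. Suppose f : ℝ → ℂ is continuous, integrable, even, vanishes identically outside [−x, x], and there is a constant C₀ > 0 such that its Fourier transform satisfies |f̂(ξ)| ≤ C₀/|ξ|^{ℓ−μ+2} for all ξ ≠ 0. Define h(z) := f(xz)/(1−z²)^{ℓ+1}, c_k := ∫_{−1}^{1} h(z) P̃_k^{(ℓ+1,ℓ+1)}(z) (1−z²)^{ℓ+1} dz, and β̃_n := x · c_{2n}/√(h_{2n}) for n ∈ ℕ₀. Then there exists a constant C > 0 (depending on f, x, ℓ, μ) such that for every natural N with 2N > ℓ+1 one has ∑_{n=N+1}^{∞} |β̃_n|²/n ≤ C/N^{2ℓ−2μ+2}. -/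

import Mathlib

open MeasureTheory Set Filter

/-- The Fourier transform `f̂(ξ) = ∫ f(t) e^{-iξt} dt`. -/
noncomputable def fourierT (f : ℝ → ℂ) (ξ : ℝ) : ℂ :=
  ∫ t : ℝ, f t * Complex.exp (-Complex.I * ξ * t)

/-- The Jacobi polynomial `P_n^{(a,b)}` for real parameters `a, b`. -/
noncomputable def jacobiP (a b : ℝ) (n : ℕ) (z : ℝ) : ℝ :=
  (Real.Gamma (a + n + 1) / (n.factorial * Real.Gamma (a + b + n + 1))) *
    ∑ k ∈ Finset.range (n + 1),
      (n.choose k : ℝ) * (Real.Gamma (a + b + n + k + 1) / Real.Gamma (a + k + 1)) *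
        ((z - 1) / 2) ^ k

/-- `h_k = ∫_{-1}^1 (P_k^{(ℓ+1,ℓ+1)})² (1-z²)^{ℓ+1} dz`, the squared weighted norm. -/
noncomputable def jacobiNormSq (l : ℝ) (k : ℕ) : ℝ :=
  (2 ^ (2 * l + 3) / (2 * (k : ℝ) + 2 * l + 3)) * (Real.Gamma ((k : ℝ) + l + 2)) ^ 2 /
    (k.factorial * Real.Gamma ((k : ℝ) + 2 * l + 3))

/-- The normalized Jacobi polynomial `P̃_k^{(ℓ+1,ℓ+1)}`. -/
noncomputable def jacobiPNorm (l : ℝ) (k : ℕ) (z : ℝ) : ℝ :=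
  jacobiP (l + 1) (l + 1) k z / Real.sqrt (jacobiNormSq l k)

/-- The Fourier–Jacobi coefficient `c_k = ∫_{-1}^1 h(z) P̃_k^{(ℓ+1,ℓ+1)}(z) (1-z²)^{ℓ+1} dz`
of `h(z) = f(xz)/(1-z²)^{ℓ+1}`. -/
noncomputable def cJ (l x : ℝ) (f : ℝ → ℂ) (k : ℕ) : ℂ :=
  ∫ z in Set.Ioo (-1 : ℝ) 1,
    (f (x * z) / (((1 - z ^ 2) ^ (l + 1) : ℝ) : ℂ)) *
      (((jacobiPNorm l k z * (1 - z ^ 2) ^ (l + 1)) : ℝ) : ℂ)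


/-- The coefficient `β̃_n = x · c_{2n} / √(h_{2n})`. -/
noncomputable def betaT (l x : ℝ) (f : ℝ → ℂ) (n : ℕ) : ℂ :=
  (x : ℂ) * cJ l x f (2 * n) / ((Real.sqrt (jacobiNormSq l (2 * n)) : ℝ) : ℂ)

/-- The trigonometric moment `∫_{-1}^1 m(z) cos (t z + θ) dz`. -/
noncomputable def phaseCos (m : ℝ → ℝ) (θ t : ℝ) : ℝ :=
  ∫ z in (-1 : ℝ)..1, m z * Real.cos (t * z + θ)

/-- The Poisson integral `∫_{-1}^1 (1-z²)^b cos (t z) dz`, a multiple of `t^{-b-1/2} J_{b+1/2}(t)`. -/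
noncomputable def poissonCos (b t : ℝ) : ℝ :=
  phaseCos (fun z => (1 - z ^ 2) ^ b) 0 t

theorem phaseCos_hasDerivAt {m : ℝ → ℝ} (hm : Continuous m) (θ t : ℝ) :
    HasDerivAt (phaseCos m θ) (phaseCos (fun z => z * m z) (θ + Real.pi / 2) t) t := by
  have key := intervalIntegral.hasDerivAt_integral_of_dominated_loc_of_deriv_le
    (μ := volume) (a := (-1 : ℝ)) (b := 1)
    (F := fun t z => m z * Real.cos (t * z + θ))
    (F' := fun t z => z * m z * Real.cos (t * z + (θ + Real.pi / 2))) (x₀ := t)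
    (s := univ) (bound := fun z => |z * m z|) univ_mem
    (Eventually.of_forall fun t => (Continuous.aestronglyMeasurable (by fun_prop)))
    (Continuous.intervalIntegrable (by fun_prop) _ _)
    (Continuous.aestronglyMeasurable (by fun_prop))
    (Eventually.of_forall fun z _ t _ => by
      rw [norm_mul, Real.norm_eq_abs]
      exact mul_le_of_le_one_right (abs_nonneg _) (Real.abs_cos_le_one _))
    (Continuous.intervalIntegrable (by fun_prop) _ _)
    (Eventually.of_forall fun z _ t _ => by
      have h1 : HasDerivAt (fun t : ℝ => t * z + θ) z t := by
        simpa using ((hasDerivAt_id t).mul_const z).add_const θ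
      refine ((h1.cos).const_mul (m z)).congr_deriv ?_
      rw [← add_assoc, Real.cos_add_pi_div_two]; ring)
  exact key.2

theorem phaseCos_congr {m m' : ℝ → ℝ} (h : ∀ z ∈ Icc (-1 : ℝ) 1, m z = m' z) (θ t : ℝ) :
    phaseCos m θ t = phaseCos m' θ t := by
  unfold phaseCos
  apply intervalIntegral.integral_congr
  intro z hz
  rw [uIcc_of_le (by norm_num)] at hz
  simp only [h z hz]

theorem phaseCos_const_mul (c : ℝ) (m : ℝ → ℝ) (θ t : ℝ) :
    phaseCos (fun z => c * m z) θ t = c * phaseCos m θ t := by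
  unfold phaseCos
  rw [← intervalIntegral.integral_const_mul]
  simp only [mul_assoc]

theorem phaseCos_add {m m' : ℝ → ℝ} (hm : Continuous m) (hm' : Continuous m') (θ t : ℝ) :
    phaseCos (fun z => m z + m' z) θ t = phaseCos m θ t + phaseCos m' θ t := by
  unfold phaseCos
  rw [← intervalIntegral.integral_add (Continuous.intervalIntegrable (by fun_prop) _ _)
    (Continuous.intervalIntegrable (by fun_prop) _ _)]
  simp only [add_mul]

theorem phaseCos_add_pi (m : ℝ → ℝ) (θ t : ℝ) :
    phaseCos m (θ + Real.pi) t = -phaseCos m θ t := by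
  unfold phaseCos
  rw [← intervalIntegral.integral_neg]
  simp only [← add_assoc, Real.cos_add_pi, mul_neg]

theorem abs_phaseCos_le {m : ℝ → ℝ} {C : ℝ} (hC : ∀ z ∈ Icc (-1 : ℝ) 1, |m z| ≤ C) (θ t : ℝ) :
    |phaseCos m θ t| ≤ 2 * C := by
  have := intervalIntegral.norm_integral_le_of_norm_le_const (a := (-1 : ℝ)) (b := 1)
    (f := fun z => m z * Real.cos (t * z + θ)) (C := C) (by
      intro z hz
      rw [uIoc_of_le (by norm_num)] at hz
      rw [norm_mul, Real.norm_eq_abs]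
      exact (mul_le_of_le_one_right (abs_nonneg _) (Real.abs_cos_le_one _)).trans
        (hC z (Ioc_subset_Icc_self hz)))
  rw [Real.norm_eq_abs] at this
  unfold phaseCos
  convert this using 1
  norm_num [mul_comm]

/-- Integration by parts when the boundary values vanish. -/
theorem phaseCos_deriv {g g' : ℝ → ℝ} (hg : Continuous g) (hg' : Continuous g')
    (hd : ∀ z ∈ Ioo (-1 : ℝ) 1, HasDerivAt g (g' z) z) (h1 : g 1 = 0) (h2 : g (-1) = 0)
    (θ t : ℝ) :
    phaseCos g' θ t = t * phaseCos g (θ - Real.pi / 2) t := by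
  unfold phaseCos
  have := intervalIntegral.integral_deriv_mul_eq_sub_of_hasDerivAt (a := (-1 : ℝ)) (b := 1)
    (u := g) (u' := g') (v := fun z => Real.cos (t * z + θ))
    (v' := fun z => -(Real.sin (t * z + θ)) * t) (by fun_prop) (by fun_prop)
    (by
      intro z hz
      rw [min_eq_left (by norm_num), max_eq_right (by norm_num)] at hz
      exact hd z hz)
    (by
      intro z _
      have h1 : HasDerivAt (fun z : ℝ => t * z + θ) t z := by
        simpa using ((hasDerivAt_id z).const_mul t).add_const θ
      exact h1.cos)
    (Continuous.intervalIntegrable (by fun_prop) _ _)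
    (Continuous.intervalIntegrable (by fun_prop) _ _)
  rw [intervalIntegral.integral_add (Continuous.intervalIntegrable (by fun_prop) _ _)
    (Continuous.intervalIntegrable (by fun_prop) _ _), h1, h2] at this
  have h3 : ∀ z, Real.cos (t * z + (θ - Real.pi / 2)) = Real.sin (t * z + θ) := by
    intro z; rw [← add_sub_assoc, Real.cos_sub_pi_div_two]
  simp only [h3]
  rw [← intervalIntegral.integral_const_mul]
  have h4 : ∫ z in (-1 : ℝ)..1, g z * (-(Real.sin (t * z + θ)) * t) =
      -∫ z in (-1 : ℝ)..1, t * (g z * Real.sin (t * z + θ)) := by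
    rw [← intervalIntegral.integral_neg]; congr 1; ext z; ring
  rw [h4] at this
  linarith

theorem continuous_weight {b : ℝ} (hb : 0 ≤ b) : Continuous fun z : ℝ => (1 - z ^ 2) ^ b :=
  Continuous.rpow_const (by fun_prop) fun _ => Or.inr hb

theorem hasDerivAt_weight {b : ℝ} (hb : 0 ≤ b) (z : ℝ) :
    HasDerivAt (fun z : ℝ => (1 - z ^ 2) ^ (b + 1)) (-(2 * (b + 1)) * (z * (1 - z ^ 2) ^ b)) z := by
  have h1 : HasDerivAt (fun z : ℝ => 1 - z ^ 2) (-(2 * z)) z := by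
    simpa using (hasDerivAt_pow 2 z).const_sub 1
  have := h1.rpow_const (p := b + 1) (Or.inr (by linarith))
  convert this using 1
  rw [add_sub_cancel_right]; ring

theorem weight_succ {b : ℝ} (hb : 0 ≤ b) {z : ℝ} (hz : z ∈ Icc (-1 : ℝ) 1) :
    (1 - z ^ 2) ^ (b + 1) = (1 - z ^ 2) * (1 - z ^ 2) ^ b := by
  have : 0 ≤ 1 - z ^ 2 := by nlinarith [hz.1, hz.2]
  rw [Real.rpow_add_of_nonneg this hb (by norm_num), Real.rpow_one, mul_comm]

theorem poissonCos_hasDerivAt {b : ℝ} (hb : 0 ≤ b) (t : ℝ) :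
    HasDerivAt (poissonCos b) (-(t / (2 * (b + 1))) * poissonCos (b + 1) t) t := by
  have h := phaseCos_hasDerivAt (continuous_weight hb) 0 t
  have hw := continuous_weight hb
  have hw1 := continuous_weight (b := b + 1) (by linarith)
  have h2 := phaseCos_deriv hw1 (g' := fun z => -(2 * (b + 1)) * (z * (1 - z ^ 2) ^ b))
    (by fun_prop) (fun z _ => hasDerivAt_weight hb z)
    (by norm_num; rw [Real.zero_rpow (by linarith)])
    (by norm_num; rw [Real.zero_rpow (by linarith)]) (0 + Real.pi / 2) t
  rw [phaseCos_const_mul, add_sub_cancel_right] at h2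
  have h3 : phaseCos (fun z => z * (1 - z ^ 2) ^ b) (0 + Real.pi / 2) t =
      -(t / (2 * (b + 1))) * poissonCos (b + 1) t := by
    unfold poissonCos
    have : (b + 1) ≠ 0 := by linarith
    rw [neg_mul, div_mul_eq_mul_div, eq_neg_iff_add_eq_zero, ← h2]
    field_simp
    ring
  rw [← h3]
  exact h

theorem poissonCos_relation {b : ℝ} (hb : 0 ≤ b) (t : ℝ) :
    t * (-(t / (2 * (b + 1 + 1))) * poissonCos (b + 1 + 1) t) =
      2 * (b + 1) * poissonCos b t - (2 * b + 3) * poissonCos (b + 1) t := by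
  have hw := continuous_weight hb
  have hb1 : 0 ≤ b + 1 := by linarith
  have hw1 := continuous_weight hb1
  have e1 := (poissonCos_hasDerivAt hb1 t).unique (phaseCos_hasDerivAt hw1 0 t)
  rw [e1]
  have h2 := phaseCos_deriv (g := fun z => z * (1 - z ^ 2) ^ (b + 1))
    (g' := fun z => (1 - z ^ 2) ^ (b + 1) + z * (-(2 * (b + 1)) * (z * (1 - z ^ 2) ^ b)))
    (by fun_prop) (by fun_prop)
    (fun z _ => ((hasDerivAt_id z).mul (hasDerivAt_weight hb z)).congr_deriv (by simp))
    (by norm_num; rw [Real.zero_rpow (by linarith)])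
    (by norm_num; rw [Real.zero_rpow (by linarith)]) 0 t
  have h3 : phaseCos (fun z => z * (1 - z ^ 2) ^ (b + 1)) (0 + Real.pi / 2) t =
      -phaseCos (fun z => z * (1 - z ^ 2) ^ (b + 1)) (0 - Real.pi / 2) t := by
    rw [← phaseCos_add_pi]; congr 1; ring
  have h4 : phaseCos (fun z => (1 - z ^ 2) ^ (b + 1) +
      z * (-(2 * (b + 1)) * (z * (1 - z ^ 2) ^ b))) 0 t =
      (2 * b + 3) * poissonCos (b + 1) t - 2 * (b + 1) * poissonCos b t := by
    unfold poissonCos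
    rw [sub_eq_add_neg, ← neg_mul (2 * (b + 1)) (phaseCos _ 0 t), ← phaseCos_const_mul,
      ← phaseCos_const_mul, ← phaseCos_add (by fun_prop) (by fun_prop)]
    apply phaseCos_congr
    intro z hz
    simp only [weight_succ hb hz]
    ring
  rw [h3]
  rw [h4] at h2
  linarith

theorem poissonCos_succ_hasDerivAt {b : ℝ} (hb : 0 ≤ b) {t : ℝ} (ht : t ≠ 0) :
    HasDerivAt (poissonCos (b + 1))
      ((2 * (b + 1) * poissonCos b t - (2 * b + 3) * poissonCos (b + 1) t) / t) t := by
  convert poissonCos_hasDerivAt (b := b + 1) (by linarith) t using 1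
  rw [← poissonCos_relation hb t]
  field_simp

theorem continuous_poissonCos {b : ℝ} (hb : 0 ≤ b) : Continuous (poissonCos b) :=
  continuous_iff_continuousAt.2 fun t => (poissonCos_hasDerivAt hb t).continuousAt

theorem weight_mem_Icc {b : ℝ} (hb : 0 ≤ b) {z : ℝ} (hz : z ∈ Icc (-1 : ℝ) 1) :
    (1 - z ^ 2) ^ b ∈ Icc (0 : ℝ) 1 := by
  have : 0 ≤ 1 - z ^ 2 := by nlinarith [hz.1, hz.2]
  exact ⟨Real.rpow_nonneg this _, Real.rpow_le_one this (by nlinarith) hb⟩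

theorem abs_poissonCos_le {b : ℝ} (hb : 0 ≤ b) (t : ℝ) : |poissonCos b t| ≤ 2 := by
  have := abs_phaseCos_le (m := fun z => (1 - z ^ 2) ^ b) (C := 1)
    (fun z hz => by
      obtain ⟨h1, h2⟩ := weight_mem_Icc hb hz
      rw [abs_of_nonneg h1]; exact h2) 0 t
  simpa [poissonCos] using this

theorem poissonCos_zero_pos {b : ℝ} (hb : 0 ≤ b) : 0 < poissonCos b 0 := by
  unfold poissonCos phaseCos
  apply intervalIntegral.intervalIntegral_pos_of_pos_on
  · apply Continuous.intervalIntegrable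
    have := continuous_weight hb
    fun_prop
  · intro z hz
    simp only [zero_mul, add_zero, Real.cos_zero, mul_one]
    exact Real.rpow_pos_of_pos (by nlinarith [hz.1, hz.2]) _
  · norm_num

/-- The Riccati–Bessel function, a constant multiple of `√t J_{b+1/2}(t)`. -/
noncomputable def riccatiBessel (b t : ℝ) : ℝ :=
  t ^ (b + 1) * poissonCos b t / (2 ^ b * Real.Gamma (b + 1))

theorem riccatiBessel_const_pos {b : ℝ} (hb : 0 ≤ b) : 0 < 2 ^ b * Real.Gamma (b + 1) :=
  mul_pos (by positivity) (Real.Gamma_pos_of_pos (by linarith))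

theorem riccatiBessel_const_succ {b : ℝ} (hb : 0 ≤ b) :
    2 ^ (b + 1) * Real.Gamma (b + 1 + 1) = 2 * (b + 1) * (2 ^ b * Real.Gamma (b + 1)) := by
  rw [Real.Gamma_add_one (by linarith), Real.rpow_add_one (by norm_num)]; ring

theorem riccatiBessel_succ_eq {b : ℝ} (hb : 0 ≤ b) {t : ℝ} (ht : 0 < t) :
    riccatiBessel (b + 1) t = t ^ (b + 1) * (t / (2 * (b + 1)) * poissonCos (b + 1) t) /
      (2 ^ b * Real.Gamma (b + 1)) := by
  unfold riccatiBessel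
  rw [riccatiBessel_const_succ hb, Real.rpow_add_one ht.ne']
  have := riccatiBessel_const_pos hb
  field_simp

theorem riccatiBessel_hasDerivAt {b : ℝ} (hb : 0 ≤ b) {t : ℝ} (ht : 0 < t) :
    HasDerivAt (riccatiBessel b)
      ((b + 1) / t * riccatiBessel b t - riccatiBessel (b + 1) t) t := by
  have h1 := Real.hasDerivAt_rpow_const (x := t) (p := b + 1) (Or.inl ht.ne')
  have h2 := (h1.mul (poissonCos_hasDerivAt hb t)).div_const (2 ^ b * Real.Gamma (b + 1))
  refine h2.congr_deriv ?_
  rw [riccatiBessel_succ_eq hb ht, riccatiBessel, Real.rpow_sub_one ht.ne']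
  have := riccatiBessel_const_pos hb
  field_simp
  ring

theorem riccatiBessel_succ_hasDerivAt {b : ℝ} (hb : 0 ≤ b) {t : ℝ} (ht : 0 < t) :
    HasDerivAt (riccatiBessel (b + 1))
      (riccatiBessel b t - (b + 1) / t * riccatiBessel (b + 1) t) t := by
  have h1 := Real.hasDerivAt_rpow_const (x := t) (p := b + 1 + 1) (Or.inl ht.ne')
  have h2 := (h1.mul (poissonCos_succ_hasDerivAt hb ht.ne')).div_const
    (2 ^ (b + 1) * Real.Gamma (b + 1 + 1))
  refine h2.congr_deriv ?_
  rw [riccatiBessel_succ_eq hb ht, riccatiBessel, riccatiBessel_const_succ hb,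
    add_sub_cancel_right, Real.rpow_add_one ht.ne' (b + 1)]
  have := riccatiBessel_const_pos hb
  field_simp
  ring

theorem riccatiBessel_relation {b : ℝ} (hb : 0 ≤ b) {t : ℝ} (ht : 0 < t) :
    (b + 1 + 1) / t * riccatiBessel (b + 1) t - riccatiBessel (b + 1 + 1) t =
      riccatiBessel b t - (b + 1) / t * riccatiBessel (b + 1) t :=
  (riccatiBessel_hasDerivAt (b := b + 1) (by linarith) ht).unique
    (riccatiBessel_succ_hasDerivAt hb ht)

/-- With `v = riccatiBessel b`, this is the energy `v'² + (1 - b(b+1)/t²) v²`. -/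
noncomputable def besselEnergy (b t : ℝ) : ℝ :=
  ((b + 1) / t * riccatiBessel b t - riccatiBessel (b + 1) t) ^ 2 +
    (1 - b * (b + 1) / t ^ 2) * riccatiBessel b t ^ 2

theorem besselEnergy_hasDerivAt {b : ℝ} (hb : 0 ≤ b) {t : ℝ} (ht : 0 < t) :
    HasDerivAt (besselEnergy b) (2 * (b * (b + 1)) / t ^ 3 * riccatiBessel b t ^ 2) t := by
  have hv := riccatiBessel_hasDerivAt hb ht
  have hw := riccatiBessel_succ_hasDerivAt hb ht
  have h1 : HasDerivAt (fun t : ℝ => (b + 1) / t) (-(b + 1) / t ^ 2) t := by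
    simp only [div_eq_mul_inv]
    exact ((hasDerivAt_inv ht.ne').const_mul (b + 1)).congr_deriv (by ring)
  have h2 : HasDerivAt (fun t : ℝ => 1 - b * (b + 1) / t ^ 2) (2 * (b * (b + 1)) / t ^ 3) t := by
    have := (((hasDerivAt_pow 2 t).inv (by positivity)).const_mul (b * (b + 1))).const_sub 1
    refine this.congr_deriv ?_
    field_simp
    ring
  have := (((h1.mul hv).sub hw).pow 2).add (h2.mul (hv.pow 2))
  refine this.congr_deriv ?_
  simp only [Pi.mul_apply, Pi.sub_apply, Pi.pow_apply, Nat.cast_ofNat, Nat.add_one_sub_one,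
    pow_one]
  field_simp
  ring

theorem besselEnergy_succ_le {b : ℝ} (hb : 0 ≤ b) {t : ℝ} (ht : 0 < t) :
    besselEnergy (b + 1) t ≤ besselEnergy b t := by
  have h := riccatiBessel_relation hb ht
  have : besselEnergy b t - besselEnergy (b + 1) t =
      (b + 1) / t ^ 2 * (riccatiBessel b t ^ 2 + riccatiBessel (b + 1) t ^ 2) := by
    unfold besselEnergy
    rw [h]
    field_simp
    ring
  have h2 : 0 ≤ (b + 1) / t ^ 2 * (riccatiBessel b t ^ 2 + riccatiBessel (b + 1) t ^ 2) := by
    positivity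
  linarith

theorem besselEnergy_add_nat_le {b : ℝ} (hb : 0 ≤ b) {t : ℝ} (ht : 0 < t) (k : ℕ) :
    besselEnergy (b + k) t ≤ besselEnergy b t := by
  induction k with
  | zero => simp
  | succ k ih =>
    push_cast
    rw [← add_assoc]
    exact (besselEnergy_succ_le (by positivity) ht).trans ih

theorem sq_riccatiBessel_le {b : ℝ} {t : ℝ} (ht : 0 < t) (h : 2 * (b * (b + 1)) ≤ t ^ 2) :
    riccatiBessel b t ^ 2 ≤ 2 * besselEnergy b t := by
  have h1 : b * (b + 1) / t ^ 2 ≤ 1 / 2 := by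
    rw [div_le_iff₀ (by positivity)]; linarith
  unfold besselEnergy
  nlinarith [sq_nonneg (riccatiBessel b t),
    sq_nonneg ((b + 1) / t * riccatiBessel b t - riccatiBessel (b + 1) t)]

theorem exists_besselEnergy_le {b : ℝ} (hb : 0 ≤ b) :
    ∃ A, 0 < A ∧ ∀ t, 0 < t → besselEnergy b t ≤ A := by
  set β := b * (b + 1) with hβ
  have hβ0 : 0 ≤ β := by positivity
  set T := 2 * (b + 1) with hT
  have hT0 : 0 < T := by positivity
  have hTβ : ∀ t, T ≤ t → 2 * β ≤ t ^ 2 := by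
    intro t ht
    nlinarith
  have hnn : ∀ t, T ≤ t → 0 ≤ besselEnergy b t := by
    intro t ht
    have := sq_riccatiBessel_le (b := b) (hT0.trans_le ht) (hTβ t ht)
    nlinarith [sq_nonneg (riccatiBessel b t)]
  have hG : ∀ t, 0 < t → HasDerivAt (fun t => besselEnergy b t * Real.exp (2 * β / t ^ 2))
      ((2 * β / t ^ 3 * riccatiBessel b t ^ 2 - 4 * β / t ^ 3 * besselEnergy b t) *
        Real.exp (2 * β / t ^ 2)) t := by
    intro t ht
    have h2 : HasDerivAt (fun t : ℝ => 2 * β / t ^ 2) (-(4 * β / t ^ 3)) t := by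
      have := ((hasDerivAt_pow 2 t).inv (by positivity)).const_mul (2 * β)
      refine this.congr_deriv ?_
      field_simp
      ring
    refine ((besselEnergy_hasDerivAt hb ht).mul h2.exp).congr_deriv ?_
    ring
  have hanti : AntitoneOn (fun t => besselEnergy b t * Real.exp (2 * β / t ^ 2)) (Ici T) := by
    apply antitoneOn_of_deriv_nonpos (convex_Ici T)
    · intro t ht
      exact (hG t (hT0.trans_le ht)).continuousAt.continuousWithinAt
    · intro t ht
      rw [interior_Ici] at ht
      exact (hG t (hT0.trans ht)).differentiableAt.differentiableWithinAt
    · intro t ht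
      rw [interior_Ici] at ht
      have ht0 : 0 < t := hT0.trans ht
      rw [(hG t ht0).deriv]
      apply mul_nonpos_of_nonpos_of_nonneg _ (Real.exp_nonneg _)
      have := sq_riccatiBessel_le (b := b) ht0 (hTβ t (le_of_lt ht))
      have h3 : 0 ≤ 2 * β / t ^ 3 := by positivity
      have h4 : 4 * β / t ^ 3 = 2 * (2 * β / t ^ 3) := by ring
      rw [h4]
      nlinarith
  have hmono : MonotoneOn (besselEnergy b) (Ioi 0) := by
    apply monotoneOn_of_deriv_nonneg (convex_Ioi 0)
    · intro t ht
      exact (besselEnergy_hasDerivAt hb ht).continuousAt.continuousWithinAt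
    · intro t ht
      rw [interior_Ioi] at ht
      exact (besselEnergy_hasDerivAt hb ht).differentiableAt.differentiableWithinAt
    · intro t ht
      rw [interior_Ioi] at ht
      have : 0 < t := ht
      rw [(besselEnergy_hasDerivAt hb ht).deriv]
      positivity
  have hle : ∀ t, T ≤ t → besselEnergy b t ≤ besselEnergy b T * Real.exp (2 * β / T ^ 2) := by
    intro t ht
    refine le_trans ?_ (hanti self_mem_Ici ht ht)
    apply le_mul_of_one_le_right (hnn t ht)
    apply Real.one_le_exp
    positivity
  refine ⟨besselEnergy b T * Real.exp (2 * β / T ^ 2) + 1, ?_, ?_⟩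
  · have := mul_nonneg (hnn T le_rfl) (Real.exp_nonneg (2 * β / T ^ 2))
    linarith
  · intro t ht
    rcases le_total T t with h | h
    · linarith [hle t h]
    · linarith [hle T le_rfl, hmono ht (mem_Ioi.2 hT0) h]

theorem continuousOn_riccatiBessel {b : ℝ} (hb : 0 ≤ b) : ContinuousOn (riccatiBessel b) (Ioi 0) :=
  fun _ ht => (riccatiBessel_hasDerivAt hb ht).continuousAt.continuousWithinAt

theorem integral_sq_riccatiBessel_le {b A : ℝ} (hb : 5 / 2 ≤ b)
    (hA : ∀ t, 0 < t → besselEnergy b t ≤ A) :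
    IntervalIntegrable (fun t => riccatiBessel b t ^ 2 / t ^ 4) volume 0 (2 * (b + 1)) ∧
      ∫ t in (0 : ℝ)..(2 * (b + 1)), riccatiBessel b t ^ 2 / t ^ 4 ≤
        48 * A / (2 * (b + 1)) ^ 3 := by
  have hb0 : 0 ≤ b := by linarith
  set T := 2 * (b + 1) with hT
  set β := b * (b + 1) with hβ
  have hT0 : 0 < T := by positivity
  have hβ0 : 0 < β := by positivity
  have hTβ : T ^ 2 ≤ 6 * β := by nlinarith
  have hβT : 2 * β ≤ T ^ 2 := by nlinarith
  have hβ3 : β ≤ 2 * (β - 3) := by nlinarith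
  set c := 2 ^ b * Real.Gamma (b + 1) with hc
  have hc0 : 0 < c := riccatiBessel_const_pos hb0
  set φ := poissonCos b with hφ
  set ψ := fun t => poissonCos (b + 1) t / (2 * (b + 1)) with hψ
  have hφc : Continuous φ := continuous_poissonCos hb0
  have hψc : Continuous ψ := (continuous_poissonCos (by linarith)).div_const _
  have hpow : ∀ t : ℝ, 0 < t → t ^ (2 * b - 1) = (t ^ b) ^ 2 / t := by
    intro t ht
    rw [Real.rpow_sub_one ht.ne', two_mul, Real.rpow_add ht, sq]
  have hv : ∀ t, 0 < t → riccatiBessel b t = t ^ b * t * φ t / c := by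
    intro t ht
    rw [riccatiBessel, Real.rpow_add_one ht.ne']
  have hw : ∀ t, 0 < t → riccatiBessel (b + 1) t = t ^ b * t * t * ψ t / c := by
    intro t ht
    rw [riccatiBessel_succ_eq hb0 ht, Real.rpow_add_one ht.ne']
    simp only [hψ]
    ring
  set V := fun t => riccatiBessel b t with hV
  set V' := fun t => (b + 1) / t * riccatiBessel b t - riccatiBessel (b + 1) t with hV'
  set Z := fun t => V t * V' t / t ^ 2 + V t ^ 2 / t ^ 3 + T / (2 * β) * besselEnergy b t with hZ
  set Y := fun t : ℝ => t ^ (2 * b - 1) * ((φ t * ((b + 1) * φ t - t ^ 2 * ψ t) + φ t ^ 2 +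
    T / (2 * β) * (t * (((b + 1) * φ t - t ^ 2 * ψ t) ^ 2 + (t ^ 2 - β) * φ t ^ 2))) / c ^ 2)
    with hY
  have hYc : Continuous Y :=
    (Real.continuous_rpow_const (by linarith)).mul (by fun_prop)
  have hYZ : ∀ t, 0 < t → Y t = Z t := by
    intro t ht
    simp only [hY, hZ, hV, hV', besselEnergy]
    rw [hpow t ht, hv t ht, hw t ht]
    field_simp
    ring
  have hZd : ∀ t, 0 < t → HasDerivAt Z (V' t ^ 2 / t ^ 2 + (β - 3) * (V t ^ 2 / t ^ 4) -
      V t ^ 2 / t ^ 2 + T / t * (V t ^ 2 / t ^ 2)) t := by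
    intro t ht
    have d1 := riccatiBessel_hasDerivAt hb0 ht
    have d2 := riccatiBessel_succ_hasDerivAt hb0 ht
    have d3 := besselEnergy_hasDerivAt hb0 ht
    have d4 : HasDerivAt (fun t : ℝ => (b + 1) / t) (-(b + 1) / t ^ 2) t := by
      simp only [div_eq_mul_inv]
      exact ((hasDerivAt_inv ht.ne').const_mul (b + 1)).congr_deriv (by ring)
    have d5 := ((d1.mul ((d4.mul d1).sub d2)).div (hasDerivAt_pow 2 t) (by positivity)).add
      ((d1.pow 2).div (hasDerivAt_pow 3 t) (by positivity))
    have d6 := d5.add (d3.const_mul (T / (2 * β)))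
    refine d6.congr_deriv ?_
    simp only [Pi.mul_apply, Pi.sub_apply, Pi.pow_apply, Nat.cast_ofNat, Nat.add_one_sub_one,
      pow_one, hV, hV']
    generalize riccatiBessel b t = v
    generalize riccatiBessel (b + 1) t = w
    field_simp
    simp only [hβ]
    ring
  have hYd : ∀ t ∈ Ioo 0 T, HasDerivWithinAt Y (V' t ^ 2 / t ^ 2 + (β - 3) * (V t ^ 2 / t ^ 4) -
      V t ^ 2 / t ^ 2 + T / t * (V t ^ 2 / t ^ 2)) (Ioi t) t := by
    intro t ht
    refine HasDerivAt.hasDerivWithinAt ((hZd t ht.1).congr_of_eventuallyEq ?_)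
    filter_upwards [Ioi_mem_nhds ht.1] with s hs using hYZ s hs
  have hcont : IntervalIntegrable (fun t => V t ^ 2 / t ^ 4) volume 0 T := by
    have h1 : Continuous fun t : ℝ => t ^ (2 * b - 2) * (φ t / c) ^ 2 :=
      (Real.continuous_rpow_const (by linarith)).mul (by fun_prop)
    refine (h1.intervalIntegrable 0 T).congr ?_
    intro t ht
    rw [uIoc_of_le hT0.le] at ht
    have ht0 := ht.1
    simp only [hV]
    rw [hv t ht0, show 2 * b - 2 = 2 * b - 1 - 1 by ring, Real.rpow_sub_one ht0.ne', hpow t ht0]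
    field_simp
  refine ⟨hcont, ?_⟩
  have hmain := intervalIntegral.integral_le_sub_of_hasDeriv_right_of_le hT0.le hYc.continuousOn hYd
    (φ := fun t => (β - 3) * (V t ^ 2 / t ^ 4))
    (by
      rw [← intervalIntegrable_iff_integrableOn_Icc_of_le hT0.le]
      exact hcont.const_mul _)
    (by
      intro t ht
      have h1 : 1 ≤ T / t := by rw [one_le_div ht.1]; exact ht.2.le
      have h2 : 0 ≤ V t ^ 2 / t ^ 2 := by positivity
      have h3 : 0 ≤ V' t ^ 2 / t ^ 2 := by positivity
      nlinarith)
  have hY0 : Y 0 = 0 := by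
    simp only [hY]
    rw [Real.zero_rpow (by linarith), zero_mul]
  rw [hY0, sub_zero, hYZ T hT0, intervalIntegral.integral_const_mul] at hmain
  have e1 := sq_riccatiBessel_le (b := b) hT0 hβT
  have e2 := hA T hT0
  have e3 : V' T ^ 2 ≤ besselEnergy b T := by
    simp only [besselEnergy, hV']
    have : b * (b + 1) / T ^ 2 ≤ 1 := by
      rw [div_le_one (by positivity)]
      linarith
    nlinarith [sq_nonneg (riccatiBessel b T)]
  have hA0 : 0 ≤ A := by nlinarith [sq_nonneg (V' T)]
  have hZT : Z T ≤ 4 * A / T := by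
    have f1 : V T * V' T ≤ 2 * A := by
      have : V T ^ 2 ≤ 2 * A := by linarith
      nlinarith [sq_nonneg (V T - V' T)]
    have f2 : V T * V' T / T ^ 2 ≤ 2 * A / T ^ 2 := by gcongr
    have f3 : V T ^ 2 / T ^ 3 ≤ 2 * A / T ^ 3 := by gcongr; linarith
    have f4 : T / (2 * β) * besselEnergy b T ≤ T / (2 * (T ^ 2 / 6)) * A := by
      have e4 : 0 ≤ besselEnergy b T := (sq_nonneg _).trans e3
      gcongr
      linarith
    have f5 : T / (2 * (T ^ 2 / 6)) * A = 3 * A / T := by field_simp; ring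
    have hT7 : 7 ≤ T := by linarith
    have f6 : 2 * A / T ^ 2 + 2 * A / T ^ 3 ≤ A / T := by
      rw [show A / T = A * T ^ 2 / T ^ 3 by field_simp,
        show 2 * A / T ^ 2 = 2 * A * T / T ^ 3 by field_simp, ← add_div]
      gcongr
      nlinarith [mul_nonneg hA0 hT0.le]
    have f7 : 4 * A / T = A / T + 3 * A / T := by ring
    simp only [hZ]
    linarith
  have hI0 : 0 ≤ ∫ t in (0 : ℝ)..T, V t ^ 2 / t ^ 4 :=
    intervalIntegral.integral_nonneg hT0.le fun t _ => by positivity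
  have g1 : T ^ 2 / 12 * ∫ t in (0 : ℝ)..T, V t ^ 2 / t ^ 4 ≤ 4 * A / T := by
    refine le_trans ?_ (hmain.trans hZT)
    gcongr
    linarith
  rw [le_div_iff₀ (by positivity)]
  rw [le_div_iff₀ (by positivity)] at g1
  linarith

theorem integrableOn_rpow_mul_riccatiBessel {b μ : ℝ} (hb : 1 / 2 ≤ b) (hμ0 : 0 ≤ μ)
    (hμ : μ < 1 / 2) :
    IntegrableOn (fun t => t ^ (μ - 2) * |riccatiBessel b t|) (Ioi 0) := by
  have hb0 : 0 ≤ b := by linarith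
  set T := 2 * (b + 1) with hT
  have hT0 : 0 < T := by positivity
  obtain ⟨A, hA0, hA⟩ := exists_besselEnergy_le hb0
  rw [← Ioc_union_Ioi_eq_Ioi hT0.le]
  refine IntegrableOn.union ?_ ?_
  · rw [← intervalIntegrable_iff_integrableOn_Ioc_of_le hT0.le]
    have h1 := intervalIntegral.intervalIntegrable_rpow' (r := μ + b - 1) (a := 0) (b := T)
      (by linarith)
    have h2 : Continuous fun t => |poissonCos b t / (2 ^ b * Real.Gamma (b + 1))| :=
      ((continuous_poissonCos hb0).div_const _).abs
    refine (h1.mul_continuousOn h2.continuousOn).congr ?_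
    intro t ht
    rw [uIoc_of_le hT0.le] at ht
    have ht0 : 0 < t := ht.1
    simp only [riccatiBessel]
    rw [mul_div_assoc, abs_mul, abs_of_nonneg (Real.rpow_nonneg ht0.le _), ← mul_assoc,
      ← Real.rpow_add ht0]
    ring_nf
  · have h1 := (integrableOn_Ioi_rpow_of_lt (a := μ - 2) (by linarith) hT0).mul_const (2 * A + 1)
    refine Integrable.mono' h1 ?_ ?_
    · refine ContinuousOn.aestronglyMeasurable ?_ measurableSet_Ioi
      have : ContinuousOn (riccatiBessel b) (Ioi T) :=
        (continuousOn_riccatiBessel hb0).mono (Ioi_subset_Ioi hT0.le)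
      refine ContinuousOn.mul (fun t ht => ?_) this.abs
      exact (Real.continuousAt_rpow_const _ _
        (Or.inl (hT0.trans ht).ne')).continuousWithinAt
    · refine (ae_restrict_iff' measurableSet_Ioi).2 (Eventually.of_forall fun t ht => ?_)
      have ht0 : 0 < t := hT0.trans ht
      have hTt : T < t := ht
      have := sq_riccatiBessel_le (b := b) ht0 (by nlinarith)
      have h3 := hA t ht0
      rw [Real.norm_eq_abs, abs_mul, abs_abs, abs_of_nonneg (Real.rpow_nonneg ht0.le _)]
      gcongr
      exact abs_le_of_sq_le_sq (by nlinarith) (by linarith)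

theorem exists_integral_rpow_mul_riccatiBessel_le {a μ : ℝ} (ha : 1 / 2 ≤ a) (hμ0 : 0 ≤ μ)
    (hμ : μ < 1 / 2) :
    ∃ C, 0 < C ∧ ∀ k : ℕ, 2 ≤ k →
      ∫ t in Ioi 0, t ^ (μ - 2) * |riccatiBessel (a + k) t| ≤ C * (k : ℝ) ^ (μ - 1) := by
  have ha0 : 0 ≤ a := by linarith
  obtain ⟨A, hA0, hA'⟩ := exists_besselEnergy_le ha0
  refine ⟨(24 * A + 1) + 2 * (2 * A + 1), by positivity, fun k hk => ?_⟩
  have hk2 : (2 : ℝ) ≤ k := by exact_mod_cast hk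
  set b := a + k with hb
  have hb2 : 5 / 2 ≤ b := by linarith
  have hb0 : 0 ≤ b := by linarith
  have hA : ∀ t, 0 < t → besselEnergy b t ≤ A := fun t ht =>
    (besselEnergy_add_nat_le ha0 ht k).trans (hA' t ht)
  set T := 2 * (b + 1) with hT
  have hT0 : 0 < T := by positivity
  have hint := integrableOn_rpow_mul_riccatiBessel (b := b) (by linarith) hμ0 hμ
  obtain ⟨hI, hle⟩ := integral_sq_riccatiBessel_le hb2 hA
  rw [← Ioc_union_Ioi_eq_Ioi hT0.le] at hint ⊢
  rw [setIntegral_union (Ioc_disjoint_Ioi le_rfl) measurableSet_Ioi hint.left_of_union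
    hint.right_of_union]
  have hTk : T ^ (μ - 1) ≤ (k : ℝ) ^ (μ - 1) :=
    Real.rpow_le_rpow_of_nonpos (by linarith) (by linarith) (by linarith)
  have low : ∫ t in Ioc 0 T, t ^ (μ - 2) * |riccatiBessel b t| ≤ (24 * A + 1) * T ^ (μ - 1) := by
    rw [← intervalIntegral.integral_of_le hT0.le]
    have hI2 := intervalIntegral.intervalIntegrable_rpow' (r := 2 * μ) (a := 0) (b := T)
      (by linarith)
    have h1 : ∫ t in (0 : ℝ)..T, t ^ (μ - 2) * |riccatiBessel b t| ≤
        ∫ t in (0 : ℝ)..T, (T ^ (μ + 2) / 2 * (riccatiBessel b t ^ 2 / t ^ 4) +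
          (T ^ (μ + 2))⁻¹ / 2 * t ^ (2 * μ)) := by
      refine intervalIntegral.integral_mono_on_of_le_Ioo hT0.le ?_
        ((hI.const_mul _).add (hI2.const_mul _)) ?_
      · rw [intervalIntegrable_iff_integrableOn_Ioc_of_le hT0.le]
        exact hint.left_of_union
      · intro t ht
        have ht0 : 0 < t := ht.1
        have hL : 0 < T ^ (μ + 2) := by positivity
        have e1 : t ^ (μ - 2) = t ^ μ / t ^ 2 := by
          rw [Real.rpow_sub ht0]; norm_num
        have e2 : t ^ (2 * μ) = (t ^ μ) ^ 2 := by
          rw [two_mul, Real.rpow_add ht0, sq]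
        rw [e1, e2]
        have e3 : riccatiBessel b t ^ 2 / t ^ 4 = (|riccatiBessel b t| / t ^ 2) ^ 2 := by
          rw [div_pow, sq_abs]; ring
        rw [e3, show t ^ μ / t ^ 2 * |riccatiBessel b t| = t ^ μ * (|riccatiBessel b t| / t ^ 2)
          by ring]
        generalize |riccatiBessel b t| / t ^ 2 = x
        generalize t ^ μ = y
        generalize T ^ (μ + 2) = L at hL
        have : L / 2 * x ^ 2 + L⁻¹ / 2 * y ^ 2 - y * x = (L * x - y) ^ 2 / (2 * L) := by
          field_simp
          ring
        have : 0 ≤ (L * x - y) ^ 2 / (2 * L) := by positivity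
        linarith
    refine h1.trans ?_
    rw [intervalIntegral.integral_add (hI.const_mul _) (hI2.const_mul _),
      intervalIntegral.integral_const_mul, intervalIntegral.integral_const_mul,
      integral_rpow (Or.inl (by linarith)), Real.zero_rpow (by linarith), sub_zero]
    have e1 : T ^ (μ + 2) / 2 * ∫ t in (0 : ℝ)..T, riccatiBessel b t ^ 2 / t ^ 4 ≤
        24 * A * T ^ (μ - 1) := by
      have : T ^ (μ + 2) = T ^ (μ - 1) * T ^ 3 := by
        rw [← Real.rpow_natCast T 3, ← Real.rpow_add hT0]; norm_num
        ring_nf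
      calc _ ≤ T ^ (μ + 2) / 2 * (48 * A / T ^ 3) := by gcongr
        _ = _ := by rw [this]; field_simp; ring
    have e2 : (T ^ (μ + 2))⁻¹ / 2 * (T ^ (2 * μ + 1) / (2 * μ + 1)) ≤ T ^ (μ - 1) := by
      rw [← Real.rpow_neg hT0.le]
      have : T ^ (-(μ + 2)) * T ^ (2 * μ + 1) = T ^ (μ - 1) := by
        rw [← Real.rpow_add hT0]; ring_nf
      calc _ = T ^ (-(μ + 2)) * T ^ (2 * μ + 1) / (2 * (2 * μ + 1)) := by field_simp
        _ = T ^ (μ - 1) / (2 * (2 * μ + 1)) := by rw [this]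
        _ ≤ _ := div_le_self (by positivity) (by linarith)
    linarith
  have high : ∫ t in Ioi T, t ^ (μ - 2) * |riccatiBessel b t| ≤
      2 * (2 * A + 1) * T ^ (μ - 1) := by
    have h1 := (integrableOn_Ioi_rpow_of_lt (a := μ - 2) (by linarith) hT0).mul_const (2 * A + 1)
    have h2 : ∫ t in Ioi T, t ^ (μ - 2) * |riccatiBessel b t| ≤
        ∫ t in Ioi T, t ^ (μ - 2) * (2 * A + 1) := by
      refine setIntegral_mono_on hint.right_of_union h1 measurableSet_Ioi fun t ht => ?_
      have ht0 : 0 < t := hT0.trans ht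
      have hTt : T < t := ht
      have := sq_riccatiBessel_le (b := b) ht0 (by nlinarith)
      have h3 := hA t ht0
      gcongr
      exact abs_le_of_sq_le_sq (by nlinarith) (by linarith)
    refine h2.trans ?_
    rw [integral_mul_const, integral_Ioi_rpow_of_lt (by linarith) hT0]
    have : -T ^ (μ - 2 + 1) / (μ - 2 + 1) = T ^ (μ - 1) / (1 - μ) := by
      rw [show μ - 2 + 1 = -(1 - μ) by ring, neg_div_neg_eq]
      ring_nf
    rw [this]
    have : T ^ (μ - 1) / (1 - μ) ≤ 2 * T ^ (μ - 1) := by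
      rw [div_le_iff₀ (by linarith)]
      have : 0 < T ^ (μ - 1) := by positivity
      nlinarith
    nlinarith
  have h0 : 0 ≤ (k : ℝ) ^ (μ - 1) := by positivity
  nlinarith

/-- Continuous functions decaying faster than any power. -/
def RapidDecay (φ : ℝ → ℝ) : Prop :=
  Continuous φ ∧ ∀ n : ℕ, ∃ C, ∀ ξ, |ξ ^ n * φ ξ| ≤ C

theorem RapidDecay.const_mul {φ : ℝ → ℝ} (h : RapidDecay φ) (c : ℝ) :
    RapidDecay fun ξ => c * φ ξ := by
  refine ⟨continuous_const.mul h.1, fun n => ?_⟩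
  obtain ⟨C, hC⟩ := h.2 n
  refine ⟨|c| * C, fun ξ => ?_⟩
  rw [mul_left_comm, abs_mul]
  gcongr
  exact hC ξ

theorem RapidDecay.add {φ ψ : ℝ → ℝ} (h : RapidDecay φ) (h' : RapidDecay ψ) :
    RapidDecay fun ξ => φ ξ + ψ ξ := by
  refine ⟨h.1.add h'.1, fun n => ?_⟩
  obtain ⟨C, hC⟩ := h.2 n
  obtain ⟨C', hC'⟩ := h'.2 n
  refine ⟨C + C', fun ξ => ?_⟩
  rw [mul_add]
  exact (abs_add_le _ _).trans (add_le_add (hC ξ) (hC' ξ))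

theorem RapidDecay.id_mul {φ : ℝ → ℝ} (h : RapidDecay φ) : RapidDecay fun ξ => ξ * φ ξ := by
  refine ⟨continuous_id.mul h.1, fun n => ?_⟩
  obtain ⟨C, hC⟩ := h.2 (n + 1)
  exact ⟨C, fun ξ => by rw [← mul_assoc, ← pow_succ]; exact hC ξ⟩

theorem RapidDecay.bounded_mul {φ j : ℝ → ℝ} (h : RapidDecay φ) (hj : Continuous j) {B : ℝ}
    (hB : ∀ ξ, |j ξ| ≤ B) : RapidDecay fun ξ => j ξ * φ ξ := by
  refine ⟨hj.mul h.1, fun n => ?_⟩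
  obtain ⟨C, hC⟩ := h.2 n
  refine ⟨B * C, fun ξ => ?_⟩
  rw [mul_left_comm, abs_mul]
  exact mul_le_mul (hB ξ) (hC ξ) (abs_nonneg _) ((abs_nonneg _).trans (hB 0))

theorem RapidDecay.exists_rpow_le {φ : ℝ → ℝ} (h : RapidDecay φ) (s : ℝ) :
    ∃ C, ∀ ξ, 1 ≤ ξ → |ξ ^ s * φ ξ| ≤ C * ξ ^ (-2 : ℝ) := by
  obtain ⟨n, hn⟩ := exists_nat_ge (s + 2)
  obtain ⟨C, hC⟩ := h.2 n
  refine ⟨C, fun ξ hξ => ?_⟩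
  have h0 : 0 < ξ := by linarith
  rw [Real.rpow_neg h0.le, ← div_eq_mul_inv, le_div_iff₀ (by positivity)]
  refine le_trans ?_ (hC ξ)
  rw [abs_mul, abs_mul, abs_of_nonneg (Real.rpow_nonneg h0.le _), abs_of_nonneg (pow_nonneg h0.le _),
    mul_right_comm, ← Real.rpow_add h0]
  gcongr
  rw [← Real.rpow_natCast]
  exact Real.rpow_le_rpow_of_exponent_le hξ hn

theorem RapidDecay.integrableOn_rpow_mul {φ : ℝ → ℝ} (h : RapidDecay φ) {s : ℝ} (hs : 0 ≤ s) :
    IntegrableOn (fun ξ => ξ ^ s * φ ξ) (Ioi 0) := by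
  have hc : Continuous fun ξ => ξ ^ s * φ ξ := (Real.continuous_rpow_const hs).mul h.1
  rw [← Ioc_union_Ioi_eq_Ioi zero_le_one]
  refine IntegrableOn.union (hc.integrableOn_Icc.mono_set Ioc_subset_Icc_self) ?_
  obtain ⟨C, hC⟩ := h.exists_rpow_le s
  refine Integrable.mono' ((integrableOn_Ioi_rpow_of_lt (a := (-2 : ℝ)) (by norm_num)
    zero_lt_one).const_mul C) hc.aestronglyMeasurable ?_
  exact (ae_restrict_iff' measurableSet_Ioi).2 (Eventually.of_forall fun ξ hξ =>
    hC ξ (le_of_lt hξ))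

theorem RapidDecay.tendsto_rpow_mul {φ : ℝ → ℝ} (h : RapidDecay φ) (s : ℝ) :
    Tendsto (fun ξ => ξ ^ s * φ ξ) atTop (nhds 0) := by
  obtain ⟨C, hC⟩ := h.exists_rpow_le s
  have h1 : Tendsto (fun ξ : ℝ => C * ξ ^ (-2 : ℝ)) atTop (nhds 0) := by
    simpa using (tendsto_rpow_neg_atTop (y := 2) (by norm_num)).const_mul C
  refine squeeze_zero_norm' ?_ h1
  filter_upwards [eventually_ge_atTop 1] with ξ hξ using hC ξ hξ

/-- The weighted moment `∫_0^∞ ξ^s j_b(ξ) φ(ξ) dξ` against the Poisson integral `j_b`. -/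
noncomputable def besselMoment (s b : ℝ) (φ : ℝ → ℝ) : ℝ :=
  ∫ ξ in Ioi (0 : ℝ), ξ ^ s * (poissonCos b ξ * φ ξ)

theorem RapidDecay.poissonCos_mul {φ : ℝ → ℝ} (h : RapidDecay φ) {b : ℝ} (hb : 0 ≤ b) :
    RapidDecay fun ξ => poissonCos b ξ * φ ξ :=
  h.bounded_mul (continuous_poissonCos hb) (abs_poissonCos_le hb)

theorem besselMoment_add {φ ψ : ℝ → ℝ} (h : RapidDecay φ) (h' : RapidDecay ψ) {s b : ℝ}
    (hs : 0 ≤ s) (hb : 0 ≤ b) :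
    besselMoment s b (fun ξ => φ ξ + ψ ξ) = besselMoment s b φ + besselMoment s b ψ := by
  unfold besselMoment
  rw [← integral_add ((h.poissonCos_mul hb).integrableOn_rpow_mul hs)
    ((h'.poissonCos_mul hb).integrableOn_rpow_mul hs)]
  simp only [mul_add]

theorem besselMoment_const_mul (s b c : ℝ) (φ : ℝ → ℝ) :
    besselMoment s b (fun ξ => c * φ ξ) = c * besselMoment s b φ := by
  unfold besselMoment
  rw [← integral_const_mul]
  congr 1; ext ξ; ring

theorem besselMoment_id_mul (s b : ℝ) (φ : ℝ → ℝ) :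
    besselMoment s b (fun ξ => ξ * φ ξ) = besselMoment (s + 1) b φ := by
  unfold besselMoment
  refine setIntegral_congr_fun measurableSet_Ioi fun ξ hξ => ?_
  simp only [Real.rpow_add_one (ne_of_gt hξ)]
  ring

/-- A total derivative `(ξ^s ψ)'` integrates to zero over the half line. -/
theorem RapidDecay.integral_deriv_eq_zero {ψ D : ℝ → ℝ} (h : RapidDecay ψ) {s : ℝ} (hs : 0 < s)
    (hD : ∀ ξ, 0 < ξ → HasDerivAt (fun ξ => ξ ^ s * ψ ξ) (D ξ) ξ) (hi : IntegrableOn D (Ioi 0)) :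
    ∫ ξ in Ioi (0 : ℝ), D ξ = 0 := by
  have hc : Continuous fun ξ => ξ ^ s * ψ ξ := (Real.continuous_rpow_const hs.le).mul h.1
  have := integral_Ioi_of_hasDerivAt_of_tendsto (a := 0) (hc.continuousWithinAt) hD hi
    (h.tendsto_rpow_mul s)
  rw [this, Real.zero_rpow hs.ne']
  simp

theorem besselMoment_eigen {a : ℝ} (ha : 0 ≤ a) (k : ℕ) {φ φ₁ φ₂ : ℝ → ℝ} (h : RapidDecay φ)
    (h₁ : RapidDecay φ₁) (h₂ : RapidDecay φ₂) (hd : ∀ ξ, HasDerivAt φ (φ₁ ξ) ξ)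
    (hd₁ : ∀ ξ, HasDerivAt φ₁ (φ₂ ξ) ξ) :
    besselMoment (2 * a + k) (a + k) (fun ξ => -1 * (ξ * (ξ * φ ξ)) + -1 * (ξ * (ξ * φ₂ ξ)) +
      -(2 * a + 2) * (ξ * φ₁ ξ)) =
      -(k * (2 * a + k + 1)) * besselMoment (2 * a + k) (a + k) φ := by
  have hk : (0 : ℝ) ≤ k := k.cast_nonneg
  have hb : 0 ≤ a + k := by positivity
  have hr : RapidDecay fun ξ => -1 * (ξ * (ξ * φ ξ)) + -1 * (ξ * (ξ * φ₂ ξ)) +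
      -(2 * a + 2) * (ξ * φ₁ ξ) :=
    ((h.id_mul.id_mul.const_mul _).add (h₂.id_mul.id_mul.const_mul _)).add (h₁.id_mul.const_mul _)
  have hz : besselMoment (2 * a + k) (a + k) (fun ξ => (-1 * (ξ * (ξ * φ ξ)) +
      -1 * (ξ * (ξ * φ₂ ξ)) + -(2 * a + 2) * (ξ * φ₁ ξ)) + (k * (2 * a + k + 1)) * φ ξ) = 0 := by
    have hψ : RapidDecay fun ξ => -1 * (poissonCos (a + k) ξ * (ξ * φ₁ ξ)) +
        k * (poissonCos (a + k) ξ * φ ξ) +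
        -(1 / (2 * (a + k + 1))) * (poissonCos (a + k + 1) ξ * (ξ * (ξ * φ ξ))) :=
      (((h₁.id_mul.poissonCos_mul hb).const_mul _).add ((h.poissonCos_mul hb).const_mul _)).add
        ((h.id_mul.id_mul.poissonCos_mul (by linarith)).const_mul _)
    refine hψ.integral_deriv_eq_zero (s := 2 * a + k + 1) (by positivity) (fun ξ hξ => ?_) ?_
    · have d1 := poissonCos_hasDerivAt hb ξ
      have d2 := poissonCos_succ_hasDerivAt hb hξ.ne'
      have dp := Real.hasDerivAt_rpow_const (x := ξ) (p := 2 * a + k + 1) (Or.inl hξ.ne')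
      have di := hasDerivAt_id ξ
      have dd := dp.mul ((((d1.mul (di.mul (hd₁ ξ))).const_mul (-1)).add
        ((d1.mul (hd ξ)).const_mul (k : ℝ))).add
        ((d2.mul (di.mul (di.mul (hd ξ)))).const_mul (-(1 / (2 * (a + k + 1))))))
      refine dd.congr_deriv ?_
      simp only [Pi.mul_apply, Pi.add_apply, id, add_sub_cancel_right,
        Real.rpow_add_one hξ.ne']
      have : 2 * (a + k + 1) ≠ 0 := by positivity
      field_simp
      ring
    · exact ((hr.add (h.const_mul _)).poissonCos_mul hb).integrableOn_rpow_mul (by positivity)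
  rw [besselMoment_add hr (h.const_mul _) (by positivity) hb, besselMoment_const_mul] at hz
  linarith

theorem besselMoment_succ {b : ℝ} (hb : 0 ≤ b) {φ φ₁ : ℝ → ℝ} (h : RapidDecay φ)
    (h₁ : RapidDecay φ₁) (hd : ∀ ξ, HasDerivAt φ (φ₁ ξ) ξ) :
    besselMoment (2 * (b + 1)) (b + 1) φ =
      2 * (b + 1) * ((2 * b + 1) * besselMoment (2 * b) b φ + besselMoment (2 * b + 1) b φ₁) := by
  have hb1 : 0 ≤ b + 1 := by linarith
  have i1 := (h.poissonCos_mul hb).integrableOn_rpow_mul (s := 2 * b) (by positivity)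
  have i2 := (h₁.poissonCos_mul hb).integrableOn_rpow_mul (s := 2 * b + 1) (by positivity)
  have i3 := (h.poissonCos_mul hb1).integrableOn_rpow_mul (s := 2 * (b + 1)) (by positivity)
  have hz := (h.poissonCos_mul hb).integral_deriv_eq_zero (s := 2 * b + 1)
    (D := fun ξ => (2 * b + 1) * (ξ ^ (2 * b) * (poissonCos b ξ * φ ξ)) +
      ξ ^ (2 * b + 1) * (poissonCos b ξ * φ₁ ξ) -
      1 / (2 * (b + 1)) * (ξ ^ (2 * (b + 1)) * (poissonCos (b + 1) ξ * φ ξ))) (by positivity)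
    (fun ξ hξ => by
      have dp := Real.hasDerivAt_rpow_const (x := ξ) (p := 2 * b + 1) (Or.inl hξ.ne')
      refine (dp.mul ((poissonCos_hasDerivAt hb ξ).mul (hd ξ))).congr_deriv ?_
      rw [show 2 * (b + 1) = 2 * b + 1 + 1 by ring]
      simp only [Pi.mul_apply, add_sub_cancel_right, Real.rpow_add_one hξ.ne']
      field_simp
      ring)
    (((i1.const_mul _).add i2).sub (i3.const_mul _))
  have i12 : IntegrableOn (fun ξ => (2 * b + 1) * (ξ ^ (2 * b) * (poissonCos b ξ * φ ξ)) +
      ξ ^ (2 * b + 1) * (poissonCos b ξ * φ₁ ξ)) (Ioi 0) := (i1.const_mul _).add i2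
  rw [integral_sub i12 (i3.const_mul _), integral_add (i1.const_mul _) i2,
    integral_const_mul, integral_const_mul] at hz
  change (2 * b + 1) * besselMoment (2 * b) b φ + besselMoment (2 * b + 1) b φ₁ -
    1 / (2 * (b + 1)) * besselMoment (2 * (b + 1)) (b + 1) φ = 0 at hz
  rw [sub_eq_zero] at hz
  rw [hz]
  field_simp

/-- Smooth functions supported in a compact subinterval of `(-1, 1)`. -/
def IsTest (g : ℝ → ℝ) : Prop :=
  ContDiff ℝ (⊤ : ℕ∞) g ∧ ∃ r < 1, ∀ z, r < |z| → g z = 0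

namespace IsTest

variable {g h : ℝ → ℝ}

theorem continuous (hg : IsTest g) : Continuous g := hg.1.continuous

theorem hasDerivAt (hg : IsTest g) (z : ℝ) : HasDerivAt g (deriv g z) z :=
  (hg.1.differentiable (by simp)).differentiableAt.hasDerivAt

theorem eq_zero (hg : IsTest g) {z : ℝ} (hz : 1 ≤ |z|) : g z = 0 := by
  obtain ⟨r, hr, h⟩ := hg.2
  exact h z (hr.trans_le hz)

theorem one (hg : IsTest g) : g 1 = 0 := hg.eq_zero (by simp)

theorem neg_one (hg : IsTest g) : g (-1) = 0 := hg.eq_zero (by simp)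

theorem deriv (hg : IsTest g) : IsTest (deriv g) := by
  refine ⟨(contDiff_infty_iff_deriv.1 hg.1).2, ?_⟩
  obtain ⟨r, hr, h⟩ := hg.2
  refine ⟨r, hr, fun z hz => ?_⟩
  have : g =ᶠ[nhds z] fun _ => 0 := by
    filter_upwards [(isOpen_lt continuous_const continuous_abs).mem_nhds hz] with y hy using h y hy
  rw [this.deriv_eq, deriv_const]

theorem add (hg : IsTest g) (hh : IsTest h) : IsTest fun z => g z + h z := by
  obtain ⟨r, hr, hz⟩ := hg.2
  obtain ⟨r', hr', hz'⟩ := hh.2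
  refine ⟨hg.1.add hh.1, max r r', max_lt hr hr', fun z hm => ?_⟩
  beta_reduce
  rw [hz z ((le_max_left _ _).trans_lt hm), hz' z ((le_max_right _ _).trans_lt hm), add_zero]

theorem mul_contDiffOn (hg : IsTest g) {u : ℝ → ℝ} (hu : ContDiffOn ℝ (⊤ : ℕ∞) u (Ioo (-1) 1)) :
    IsTest fun z => u z * g z := by
  obtain ⟨r, hr, h⟩ := hg.2
  refine ⟨contDiff_iff_contDiffAt.2 fun z => ?_, r, hr, fun z hz => by simp only [h z hz, mul_zero]⟩
  by_cases hz : r < |z|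
  · have : (fun z => u z * g z) =ᶠ[nhds z] fun _ => 0 := by
      filter_upwards [(isOpen_lt continuous_const continuous_abs).mem_nhds hz] with y hy
      rw [h y hy, mul_zero]
    exact contDiffAt_const.congr_of_eventuallyEq this
  · have hz1 : z ∈ Ioo (-1 : ℝ) 1 := abs_lt.1 ((not_lt.1 hz).trans_lt hr)
    exact (hu.contDiffAt (Ioo_mem_nhds hz1.1 hz1.2)).mul hg.1.contDiffAt

theorem mul (hg : IsTest g) {u : ℝ → ℝ} (hu : ContDiff ℝ (⊤ : ℕ∞) u) :
    IsTest fun z => u z * g z :=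
  hg.mul_contDiffOn hu.contDiffOn

theorem const_mul (hg : IsTest g) (c : ℝ) : IsTest fun z => c * g z := hg.mul contDiff_const

theorem id_mul (hg : IsTest g) : IsTest fun z => z * g z := hg.mul contDiff_id

theorem comp_neg (hg : IsTest g) : IsTest fun z => g (-z) := by
  obtain ⟨r, hr, h⟩ := hg.2
  exact ⟨hg.1.comp contDiff_neg, r, hr, fun z hz => h _ (by rwa [abs_neg])⟩

theorem primitive (hg : IsTest g) (h0 : ∫ z in (-1 : ℝ)..1, g z = 0) :
    IsTest fun z => ∫ y in (-1 : ℝ)..z, g y := by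
  have hd : ∀ z, HasDerivAt (fun z => ∫ y in (-1 : ℝ)..z, g y) (g z) z := fun z =>
    intervalIntegral.integral_hasDerivAt_right (hg.continuous.intervalIntegrable _ _)
      (hg.continuous.stronglyMeasurableAtFilter _ _) hg.continuous.continuousAt
  have key : ∀ r < 1, (∀ z, r < |z| → g z = 0) → 0 ≤ r → ∀ z, r < |z| →
      ∫ y in (-1 : ℝ)..z, g y = 0 := by
    intro r hr h hr0 z hz
    rcases lt_abs.1 hz with hz | hz
    · rw [← intervalIntegral.integral_add_adjacent_intervals (b := 1)
        (hg.continuous.intervalIntegrable _ _) (hg.continuous.intervalIntegrable _ _), h0, zero_add]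
      refine intervalIntegral.integral_zero_ae (Eventually.of_forall fun y hy => h y ?_)
      exact lt_abs.2 (Or.inl ((lt_min hr hz).trans hy.1))
    · refine intervalIntegral.integral_zero_ae (Eventually.of_forall fun y hy => h y ?_)
      have : y ≤ max (-1) z := hy.2
      have : max (-1) z < -r := max_lt (by linarith) (by linarith)
      exact lt_abs.2 (Or.inr (by linarith))
  refine ⟨contDiff_infty_iff_deriv.2 ⟨fun z => (hd z).differentiableAt, ?_⟩, ?_⟩
  · rw [show _root_.deriv (fun z => ∫ y in (-1 : ℝ)..z, g y) = g from funext fun z => (hd z).deriv]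
    exact hg.1
  · obtain ⟨r, hr, h⟩ := hg.2
    exact ⟨max r 0, max_lt hr one_pos, key _ (max_lt hr one_pos)
      (fun z hz => h z ((le_max_left _ _).trans_lt hz)) (le_max_right _ _)⟩

theorem rapidDecay (hg : IsTest g) (θ : ℝ) : RapidDecay (phaseCos g θ) := by
  refine ⟨continuous_iff_continuousAt.2 fun t =>
    (phaseCos_hasDerivAt hg.continuous θ t).continuousAt, fun n => ?_⟩
  induction n generalizing g θ with
  | zero =>
    obtain ⟨C, hC⟩ := isCompact_Icc.exists_bound_of_continuousOn
      (s := Icc (-1 : ℝ) 1) hg.continuous.continuousOn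
    exact ⟨2 * C, fun ξ => by simpa using abs_phaseCos_le hC θ ξ⟩
  | succ n ih =>
    obtain ⟨C, hC⟩ := ih hg.deriv (θ + Real.pi / 2)
    refine ⟨C, fun ξ => ?_⟩
    have := phaseCos_deriv hg.continuous hg.deriv.continuous (fun z _ => hg.hasDerivAt z) hg.one
      hg.neg_one (θ + Real.pi / 2) ξ
    rw [add_sub_cancel_right] at this
    rw [pow_succ, mul_assoc, ← this]
    exact hC ξ

theorem phaseCos_deriv (hg : IsTest g) (θ t : ℝ) :
    phaseCos (_root_.deriv g) θ t = t * phaseCos g (θ - Real.pi / 2) t :=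
  _root_.phaseCos_deriv hg.continuous hg.deriv.continuous (fun z _ => hg.hasDerivAt z) hg.one
    hg.neg_one θ t

/-- The first order operator `(1-z²) d/dz + 2az`, which lowers the Jacobi parameter. -/
noncomputable def _root_.jacobiLower (a : ℝ) (g : ℝ → ℝ) (z : ℝ) : ℝ :=
  (1 - z ^ 2) * _root_.deriv g z + 2 * a * (z * g z)

theorem jacobiLower (hg : IsTest g) (a : ℝ) : IsTest (jacobiLower a g) :=
  (hg.deriv.mul (u := fun z => 1 - z ^ 2) (by fun_prop)).add (hg.id_mul.const_mul _)

theorem besselMoment_jacobiLower (hg : IsTest g) {a : ℝ} (ha : 0 ≤ a) (k : ℕ) (θ : ℝ) :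
    besselMoment (2 * a + k + 1) (a + k) (phaseCos (_root_.jacobiLower a g) (θ - Real.pi / 2)) =
      -(k * (2 * a + k + 1)) * besselMoment (2 * a + k) (a + k) (phaseCos g θ) := by
  have hm : IsTest fun z => (1 - z ^ 2) * g z := hg.mul (by fun_prop)
  have hzz := hg.id_mul.id_mul
  have hdm : ∀ z, HasDerivAt (fun z => (1 - z ^ 2) * g z)
      ((1 - z ^ 2) * _root_.deriv g z + -2 * (z * g z)) z := fun z =>
    ((((hasDerivAt_pow 2 z).const_sub 1).mul (hg.hasDerivAt z)).congr_deriv (by norm_num; ring))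
  rw [← besselMoment_eigen ha k (hg.rapidDecay θ) (hg.id_mul.rapidDecay (θ + Real.pi / 2))
    (hzz.rapidDecay (θ + Real.pi / 2 + Real.pi / 2)) (phaseCos_hasDerivAt hg.continuous θ)
    (phaseCos_hasDerivAt hg.id_mul.continuous _), ← besselMoment_id_mul]
  congr 1
  ext ξ
  have e1 : phaseCos (_root_.jacobiLower a g) (θ - Real.pi / 2) ξ =
      phaseCos (_root_.deriv fun z => (1 - z ^ 2) * g z) (θ - Real.pi / 2) ξ +
        (2 * a + 2) * phaseCos (fun z => z * g z) (θ - Real.pi / 2) ξ := by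
    rw [← phaseCos_const_mul, ← phaseCos_add hm.deriv.continuous
      (hg.id_mul.const_mul _).continuous]
    congr 1
    ext z
    rw [(hdm z).deriv, _root_.jacobiLower]
    ring
  have e2 : phaseCos (fun z => (1 - z ^ 2) * g z) θ ξ =
      phaseCos g θ ξ + -1 * phaseCos (fun z => z * (z * g z)) θ ξ := by
    rw [← phaseCos_const_mul, ← phaseCos_add hg.continuous (hzz.const_mul _).continuous]
    congr 1
    ext z
    ring
  have e3 := phaseCos_add_pi (fun z => (1 - z ^ 2) * g z) (θ - Real.pi / 2 - Real.pi / 2) ξ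
  rw [show θ - Real.pi / 2 - Real.pi / 2 + Real.pi = θ by ring] at e3
  have e4 := phaseCos_add_pi (fun z => z * g z) (θ - Real.pi / 2) ξ
  rw [show θ - Real.pi / 2 + Real.pi = θ + Real.pi / 2 by ring] at e4
  have e5 := phaseCos_add_pi (fun z => z * (z * g z)) θ ξ
  rw [show θ + Real.pi = θ + Real.pi / 2 + Real.pi / 2 by ring] at e5
  rw [e1, hm.phaseCos_deriv, e4, e5]
  rw [e2] at e3
  linear_combination (ξ ^ 2) * e3

theorem exists_jacobiLower_eq (hg : IsTest g) (hodd : ∀ z, g (-z) = -g z) (b : ℝ) :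
    ∃ h, IsTest h ∧ _root_.jacobiLower b h = g := by
  have hpos : ∀ z ∈ Ioo (-1 : ℝ) 1, 0 < 1 - z ^ 2 := fun z hz => by nlinarith [hz.1, hz.2]
  have hs : ∀ p : ℝ, ContDiffOn ℝ (⊤ : ℕ∞) (fun z : ℝ => (1 - z ^ 2) ^ p) (Ioo (-1) 1) := fun p =>
    ContDiffOn.rpow_const_of_ne (by fun_prop) fun z hz => (hpos z hz).ne'
  have hq := hg.mul_contDiffOn (hs (-b - 1))
  have hq0 : ∫ z in (-1 : ℝ)..1, (1 - z ^ 2) ^ (-b - 1) * g z = 0 := by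
    have := intervalIntegral.integral_comp_neg (a := (-1 : ℝ)) (b := 1)
      fun z => (1 - z ^ 2) ^ (-b - 1) * g z
    simp only [even_two.neg_pow, hodd, mul_neg, intervalIntegral.integral_neg, neg_neg] at this
    linarith
  have hQ := hq.primitive hq0
  have hd : ∀ z, HasDerivAt (fun z => ∫ y in (-1 : ℝ)..z, (1 - y ^ 2) ^ (-b - 1) * g y)
      ((1 - z ^ 2) ^ (-b - 1) * g z) z := fun z =>
    intervalIntegral.integral_hasDerivAt_right (hq.continuous.intervalIntegrable _ _)
      (hq.continuous.stronglyMeasurableAtFilter _ _) hq.continuous.continuousAt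
  have hh := hQ.mul_contDiffOn (hs b)
  refine ⟨_, hh, funext fun z => ?_⟩
  by_cases hz : 1 ≤ |z|
  · rw [_root_.jacobiLower, hh.deriv.eq_zero hz, hh.eq_zero hz, hg.eq_zero hz]
    ring
  · have hz1 : z ∈ Ioo (-1 : ℝ) 1 := abs_lt.1 (not_le.1 hz)
    have hw := hpos z hz1
    have d1 := (((hasDerivAt_pow 2 z).const_sub 1).rpow_const (p := b) (Or.inl hw.ne')).mul (hd z)
    have d2 := d1.deriv
    change _root_.deriv (fun z => (1 - z ^ 2) ^ b *
      ∫ y in (-1 : ℝ)..z, (1 - y ^ 2) ^ (-b - 1) * g y) z = _ at d2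
    rw [_root_.jacobiLower, d2]
    have e : (1 - z ^ 2) ^ (-b - 1) = ((1 - z ^ 2) ^ b)⁻¹ / (1 - z ^ 2) := by
      rw [Real.rpow_sub_one hw.ne', Real.rpow_neg hw.le]
    have : 0 < (1 - z ^ 2) ^ b := by positivity
    rw [Real.rpow_sub_one hw.ne', e]
    generalize (1 - z ^ 2) ^ b = w at *
    generalize 1 - z ^ 2 = v at *
    field_simp
    norm_num
    ring

theorem besselMoment_deriv (hg : IsTest g) {b : ℝ} (hb : 0 ≤ b) :
    besselMoment (2 * b) b (phaseCos (_root_.deriv g) 0) = 0 := by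
  have ho : IsTest fun z => 1 / 2 * (g z + -1 * g (-z)) :=
    (hg.add (hg.comp_neg.const_mul _)).const_mul _
  obtain ⟨h, hh, he⟩ := ho.exists_jacobiLower_eq (fun z => by rw [neg_neg]; ring) b
  have h1 := hh.besselMoment_jacobiLower hb 0 0
  rw [he] at h1
  have e : phaseCos (_root_.deriv g) 0 =
      fun ξ => ξ * phaseCos (fun z => 1 / 2 * (g z + -1 * g (-z))) (0 - Real.pi / 2) ξ := by
    ext ξ
    rw [hg.phaseCos_deriv, phaseCos_const_mul, phaseCos_add hg.continuous
      (hg.comp_neg.const_mul _).continuous, phaseCos_const_mul]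
    have : phaseCos (fun z => g (-z)) (0 - Real.pi / 2) ξ = -phaseCos g (0 - Real.pi / 2) ξ := by
      unfold phaseCos
      have := intervalIntegral.integral_comp_neg (a := (-1 : ℝ)) (b := 1)
        fun z => g z * Real.cos (ξ * z + (0 - Real.pi / 2))
      rw [neg_neg] at this
      rw [← this, ← intervalIntegral.integral_neg]
      congr 1
      ext z
      simp only [zero_sub, ← sub_eq_add_neg, Real.cos_sub_pi_div_two, mul_neg, Real.sin_neg]
      ring
    rw [this]
    ring
  rw [e, besselMoment_id_mul]
  simpa using h1

end IsTest

theorem jacobiP_zero {a : ℝ} (ha : 0 ≤ a) (z : ℝ) : jacobiP a a 0 z = 1 := by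
  have h1 : Real.Gamma (a + 1) ≠ 0 := (Real.Gamma_pos_of_pos (by linarith)).ne'
  have h2 : Real.Gamma (a + a + 1) ≠ 0 := (Real.Gamma_pos_of_pos (by linarith)).ne'
  simp only [jacobiP, Nat.cast_zero, add_zero, zero_add, Finset.range_one, Finset.sum_singleton,
    Nat.choose_self, Nat.factorial_zero, Nat.cast_one, pow_zero]
  field_simp

/-- The derivative of `jacobiP a b n`, term by term. -/
noncomputable def jacobiPDeriv (a b : ℝ) (n : ℕ) (z : ℝ) : ℝ :=
  (Real.Gamma (a + n + 1) / (n.factorial * Real.Gamma (a + b + n + 1))) *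
    ∑ k ∈ Finset.range (n + 1),
      (n.choose k : ℝ) * (Real.Gamma (a + b + n + k + 1) / Real.Gamma (a + k + 1)) *
        ((k : ℝ) * ((z - 1) / 2) ^ (k - 1) * (1 / 2))

theorem jacobiP_hasDerivAt (a b : ℝ) (n : ℕ) (z : ℝ) :
    HasDerivAt (jacobiP a b n) (jacobiPDeriv a b n z) z := by
  unfold jacobiPDeriv
  have h : HasDerivAt (fun z : ℝ => (z - 1) / 2) (1 / 2) z :=
    ((hasDerivAt_id z).sub_const 1).div_const 2
  have h2 := HasDerivAt.fun_sum (u := Finset.range (n + 1)) fun k _ =>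
    (h.pow k).const_mul ((n.choose k : ℝ) *
      (Real.Gamma (a + b + n + k + 1) / Real.Gamma (a + k + 1)))
  exact h2.const_mul _

theorem continuous_jacobiP (a b : ℝ) (n : ℕ) : Continuous (jacobiP a b n) := by
  unfold jacobiP
  fun_prop

theorem continuous_jacobiPDeriv (a b : ℝ) (n : ℕ) : Continuous (jacobiPDeriv a b n) := by
  unfold jacobiPDeriv
  fun_prop

theorem jacobiP_raise {a : ℝ} (ha : 0 ≤ a) (k : ℕ) (z : ℝ) :
    (1 - z ^ 2) * jacobiPDeriv (a + 1) (a + 1) k z -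
      2 * (a + 1) * z * jacobiP (a + 1) (a + 1) k z = -(2 * (k + 1)) * jacobiP a a (k + 1) z := by
  have hy : ∃ y, z = 1 + 2 * y := ⟨(z - 1) / 2, by ring⟩
  obtain ⟨y, rfl⟩ := hy
  unfold jacobiP jacobiPDeriv
  rw [show (1 + 2 * y - 1) / 2 = y by ring]
  push_cast
  set B : ℕ → ℝ := fun j => Real.Gamma (2 * a + k + 2 + j) / Real.Gamma (a + j + 1) with hB
  have hA : ∀ j : ℕ, Real.Gamma (a + 1 + (a + 1) + k + j + 1) / Real.Gamma (a + 1 + j + 1) *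
      (j + a + 1) = (2 * a + k + j + 2) * B j := by
    intro j
    have e1 : Real.Gamma (a + 1 + (a + 1) + k + j + 1) =
        (2 * a + k + 2 + j) * Real.Gamma (2 * a + k + 2 + j) := by
      rw [← Real.Gamma_add_one (by positivity)]; ring_nf
    have e2 : Real.Gamma (a + 1 + j + 1) = (a + j + 1) * Real.Gamma (a + j + 1) := by
      rw [← Real.Gamma_add_one (by positivity)]; ring_nf
    have e3 : 0 < Real.Gamma (a + j + 1) := Real.Gamma_pos_of_pos (by positivity)
    have e4 : 0 < a + j + 1 := by positivity
    simp only [hB]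
    rw [e1, e2]
    field_simp
    ring
  have hA' : ∀ j : ℕ, Real.Gamma (a + 1 + (a + 1) + k + j + 1) / Real.Gamma (a + 1 + j + 1) =
      B (j + 1) := by
    intro j
    simp only [hB]
    push_cast
    ring_nf
  have hN : Real.Gamma (a + 1 + k + 1) /
      (k.factorial * Real.Gamma (a + 1 + (a + 1) + k + 1)) * (2 * a + k + 2) =
      (k + 1) * (Real.Gamma (a + (k + 1) + 1) /
        ((k + 1).factorial * Real.Gamma (a + a + (k + 1) + 1))) := by
    have e1 : Real.Gamma (a + 1 + (a + 1) + k + 1) =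
        (2 * a + k + 2) * Real.Gamma (a + a + (k + 1) + 1) := by
      rw [show 2 * a + k + 2 = a + a + (k + 1) + 1 by ring,
        ← Real.Gamma_add_one (by positivity)]
      ring_nf
    have e2 : 0 < Real.Gamma (a + a + (k + 1) + 1) := Real.Gamma_pos_of_pos (by positivity)
    have e3 : 0 < 2 * a + k + 2 := by positivity
    have e4 : (0 : ℝ) < k.factorial := by positivity
    rw [e1, Nat.factorial_succ, show a + 1 + (k : ℝ) + 1 = a + (k + 1) + 1 by ring]
    push_cast
    field_simp
  have hR : ∀ j : ℕ, Real.Gamma (a + a + (k + 1) + j + 1) / Real.Gamma (a + j + 1) = B j := by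
    intro j
    simp only [hB]
    ring_nf
  simp only [hR]
  set N := Real.Gamma (a + 1 + k + 1) / (k.factorial * Real.Gamma (a + 1 + (a + 1) + k + 1))
  have hsum : ∑ j ∈ Finset.range (k + 1), ((k.choose j : ℝ) * ((2 * a + k + j + 2) * B j) * y ^ j +
      (k.choose j : ℝ) * (B (j + 1) * (j + 2 * (a + 1))) * y ^ (j + 1)) =
      (2 * a + k + 2) * ∑ j ∈ Finset.range (k + 1 + 1), ((k + 1).choose j : ℝ) * B j * y ^ j := by
    rw [Finset.sum_add_distrib]
    have hext : ∑ j ∈ Finset.range (k + 1), (k.choose j : ℝ) * ((2 * a + k + j + 2) * B j) * y ^ j =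
        ∑ j ∈ Finset.range (k + 1 + 1),
          (k.choose j : ℝ) * ((2 * a + k + j + 2) * B j) * y ^ j := by
      rw [Finset.sum_range_succ _ (k + 1), Nat.choose_succ_self]
      simp
    rw [hext, Finset.sum_range_succ' _ (k + 1), Finset.sum_range_succ' _ (k + 1), add_right_comm,
      ← Finset.sum_add_distrib, mul_add (2 * a + k + 2), Finset.mul_sum]
    congr 1
    · refine Finset.sum_congr rfl fun j hj => ?_
      have hjk : j ≤ k := Nat.lt_succ_iff.1 (Finset.mem_range.1 hj)
      have h1 : (k.choose (j + 1) : ℝ) * (j + 1) = k.choose j * (k - j) := by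
        have := Nat.choose_succ_right_eq k j
        rw [← Nat.cast_sub hjk]
        exact_mod_cast this
      rw [Nat.choose_succ_succ]
      push_cast
      linear_combination B (j + 1) * y ^ (j + 1) * h1
    · simp
  have hleft : (1 - (1 + 2 * y) ^ 2) * (N * ∑ j ∈ Finset.range (k + 1), (k.choose j : ℝ) *
      (Real.Gamma (a + 1 + (a + 1) + k + j + 1) / Real.Gamma (a + 1 + j + 1)) *
        (j * y ^ (j - 1) * (1 / 2))) - 2 * (a + 1) * (1 + 2 * y) *
      (N * ∑ j ∈ Finset.range (k + 1), (k.choose j : ℝ) *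
        (Real.Gamma (a + 1 + (a + 1) + k + j + 1) / Real.Gamma (a + 1 + j + 1)) * y ^ j) =
      -2 * N * ∑ j ∈ Finset.range (k + 1), ((k.choose j : ℝ) * ((2 * a + k + j + 2) * B j) * y ^ j +
      (k.choose j : ℝ) * (B (j + 1) * (j + 2 * (a + 1))) * y ^ (j + 1)) := by
    simp only [Finset.mul_sum]
    rw [← Finset.sum_sub_distrib]
    refine Finset.sum_congr rfl fun j _ => ?_
    rw [← hA j, ← hA' j]
    generalize Real.Gamma (a + 1 + (a + 1) + k + j + 1) / Real.Gamma (a + 1 + j + 1) = G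
    have : (j : ℝ) * y ^ j = y * (j * y ^ (j - 1)) := by
      cases j with
      | zero => simp
      | succ j => simp [pow_succ]; ring
    rw [pow_succ]
    linear_combination (-2 * N * k.choose j * G * (y + 1)) * (-this)
  rw [hleft, hsum]
  linear_combination (-2 * ∑ j ∈ Finset.range (k + 1 + 1), ((k + 1).choose j : ℝ) * B j * y ^ j) * hN

theorem IsTest.integral_deriv_mul {g : ℝ → ℝ} (hg : IsTest g) {u u' : ℝ → ℝ}
    (hu : ∀ z, HasDerivAt u (u' z) z) (hu' : Continuous u') :
    ∫ z in (-1 : ℝ)..1, (_root_.deriv g z * u z + g z * u' z) = 0 := by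
  have hc : Continuous u := continuous_iff_continuousAt.2 fun z => (hu z).continuousAt
  have := intervalIntegral.integral_deriv_mul_eq_sub (a := (-1 : ℝ)) (b := 1)
    (fun z _ => hg.hasDerivAt z) (fun z _ => hu z)
    (hg.deriv.continuous.intervalIntegrable _ _) (hu'.intervalIntegrable _ _)
  rw [this, hg.one, hg.neg_one]
  ring

theorem IsTest.integral_jacobiLower_mul {g : ℝ → ℝ} (hg : IsTest g) {a : ℝ} (ha : 0 ≤ a) (k : ℕ) :
    ∫ z in (-1 : ℝ)..1, _root_.jacobiLower a g z * jacobiP (a + 1) (a + 1) k z =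
      2 * (k + 1) * ∫ z in (-1 : ℝ)..1, g z * jacobiP a a (k + 1) z := by
  have hP := continuous_jacobiP (a + 1) (a + 1) k
  have hP' := continuous_jacobiPDeriv (a + 1) (a + 1) k
  have hP1 := continuous_jacobiP a a (k + 1)
  have hgc := hg.continuous
  have hL := (hg.jacobiLower a).continuous
  have h := hg.integral_deriv_mul (u := fun z => (1 - z ^ 2) * jacobiP (a + 1) (a + 1) k z)
    (u' := fun z => -(2 * z) * jacobiP (a + 1) (a + 1) k z +
      (1 - z ^ 2) * jacobiPDeriv (a + 1) (a + 1) k z)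
    (fun z => (((hasDerivAt_pow 2 z).const_sub 1).mul (jacobiP_hasDerivAt _ _ k z)).congr_deriv
      (by norm_num)) (by fun_prop)
  rw [← sub_eq_zero, ← h, ← intervalIntegral.integral_const_mul,
    ← intervalIntegral.integral_sub (Continuous.intervalIntegrable (by fun_prop) _ _)
      (Continuous.intervalIntegrable (by fun_prop) _ _)]
  congr 1
  ext z
  rw [_root_.jacobiLower]
  linear_combination -g z * jacobiP_raise ha k z

/-- The pairing `∫_0^∞ ξ^{2a+k} j_{a+k}(ξ) ∫_{-1}^1 f(z) cos(ξz + kπ/2) dz dξ`. -/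
noncomputable def jacobiMoment (a : ℝ) (k : ℕ) (f : ℝ → ℝ) : ℝ :=
  besselMoment (2 * a + k) (a + k) (phaseCos f (k * (Real.pi / 2)))

theorem IsTest.jacobiMoment_zero_eq {f g : ℝ → ℝ} (hf : IsTest f) (hg : IsTest g)
    (hf1 : ∫ z in (-1 : ℝ)..1, f z = 1) {b : ℝ} (hb : 0 ≤ b) :
    jacobiMoment b 0 g = jacobiMoment b 0 f * ∫ z in (-1 : ℝ)..1, g z := by
  set I := ∫ z in (-1 : ℝ)..1, g z with hI
  have ht : IsTest fun z => g z + -I * f z := hg.add (hf.const_mul _)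
  have h0 : ∫ z in (-1 : ℝ)..1, (g z + -I * f z) = 0 := by
    rw [intervalIntegral.integral_add (hg.continuous.intervalIntegrable _ _)
      ((hf.const_mul _).continuous.intervalIntegrable _ _), intervalIntegral.integral_const_mul,
      hf1, ← hI]
    ring
  have hd : ∀ z, _root_.deriv (fun z => ∫ y in (-1 : ℝ)..z, (g y + -I * f y)) z = g z + -I * f z :=
    fun z => (intervalIntegral.integral_hasDerivAt_right (ht.continuous.intervalIntegrable _ _)
      (ht.continuous.stronglyMeasurableAtFilter _ _) ht.continuous.continuousAt).deriv
  have h1 := (ht.primitive h0).besselMoment_deriv hb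
  rw [show _root_.deriv (fun z => ∫ y in (-1 : ℝ)..z, (g y + -I * f y)) = _ from funext hd,
    show phaseCos (fun z => g z + -I * f z) 0 = fun ξ => phaseCos g 0 ξ + -I * phaseCos f 0 ξ from
      funext fun ξ => by
        rw [phaseCos_add hg.continuous (hf.const_mul _).continuous, phaseCos_const_mul],
    besselMoment_add (hg.rapidDecay 0) ((hf.rapidDecay 0).const_mul _) (by positivity) hb,
    besselMoment_const_mul] at h1
  simp only [jacobiMoment, Nat.cast_zero, zero_mul, add_zero]
  linarith

theorem IsTest.jacobiMoment_zero_succ {f : ℝ → ℝ} (hf : IsTest f) {b : ℝ} (hb : 0 ≤ b) :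
    jacobiMoment (b + 1) 0 f = 2 * (b + 1) * (2 * b + 1) * jacobiMoment b 0 f := by
  simp only [jacobiMoment, Nat.cast_zero, zero_mul, add_zero]
  rw [besselMoment_succ hb (hf.rapidDecay 0) (hf.id_mul.rapidDecay _)
    (phaseCos_hasDerivAt hf.continuous 0), ← besselMoment_id_mul]
  have h := hf.id_mul.besselMoment_deriv hb
  have e : (fun ξ => ξ * phaseCos (fun z => z * f z) (0 + Real.pi / 2) ξ) =
      fun ξ => -1 * phaseCos (_root_.deriv fun z => z * f z) 0 ξ := by
    ext ξ
    have := phaseCos_add_pi (fun z => z * f z) (0 - Real.pi / 2) ξ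
    rw [show 0 - Real.pi / 2 + Real.pi = 0 + Real.pi / 2 by ring] at this
    rw [hf.id_mul.phaseCos_deriv, this]
    ring
  rw [e, besselMoment_const_mul, h]
  ring

theorem IsTest.jacobiMoment_eq {f : ℝ → ℝ} (hf : IsTest f) (hf1 : ∫ z in (-1 : ℝ)..1, f z = 1)
    (k : ℕ) {a : ℝ} (ha : 0 ≤ a) {g : ℝ → ℝ} (hg : IsTest g) :
    jacobiMoment a k g = (-2) ^ k * Real.Gamma (k + 2 * a + 1) / Real.Gamma (2 * a + 1) *
      jacobiMoment a 0 f * ∫ z in (-1 : ℝ)..1, g z * jacobiP a a k z := by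
  induction k generalizing a g with
  | zero =>
    rw [hf.jacobiMoment_zero_eq hg hf1 ha]
    have : Real.Gamma (2 * a + 1) ≠ 0 := (Real.Gamma_pos_of_pos (by positivity)).ne'
    simp only [jacobiP_zero ha, Nat.cast_zero, zero_add, pow_zero, one_mul, mul_one, div_self this]
  | succ k ih =>
    have h1 := hg.besselMoment_jacobiLower ha (k + 1) ((k + 1 : ℕ) * (Real.pi / 2))
    have h2 : besselMoment (2 * a + (k + 1 : ℕ) + 1) (a + (k + 1 : ℕ))
        (phaseCos (_root_.jacobiLower a g) ((k + 1 : ℕ) * (Real.pi / 2) - Real.pi / 2)) =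
        jacobiMoment (a + 1) k (_root_.jacobiLower a g) := by
      unfold jacobiMoment
      push_cast
      congr 1
      · ring
      · ring
      · congr 1; ring
    rw [h2, ih (by linarith) (hg.jacobiLower a), hg.integral_jacobiLower_mul ha,
      hf.jacobiMoment_zero_succ ha] at h1
    change _ = _ * jacobiMoment a (k + 1) g at h1
    have e1 : Real.Gamma (2 * (a + 1) + 1) =
        (2 * a + 2) * ((2 * a + 1) * Real.Gamma (2 * a + 1)) := by
      rw [← Real.Gamma_add_one (by positivity), show 2 * a + 2 = 2 * a + 1 + 1 by ring,
        ← Real.Gamma_add_one (by positivity)]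
      ring_nf
    have e2 : Real.Gamma (k + 2 * (a + 1) + 1) =
        (2 * a + k + 2) * Real.Gamma ((k + 1 : ℕ) + 2 * a + 1) := by
      push_cast
      rw [show 2 * a + k + 2 = (k : ℝ) + 1 + 2 * a + 1 by ring,
        ← Real.Gamma_add_one (by positivity)]
      ring_nf
    have p1 : 0 < Real.Gamma (2 * a + 1) := Real.Gamma_pos_of_pos (by positivity)
    have p2 : 0 < 2 * a + k + 2 := by positivity
    have p3 : (0 : ℝ) < k + 1 := by positivity
    have p4 : 0 < 2 * a + 1 := by positivity
    have p5 : 0 < a + 1 := by positivity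
    rw [e1, e2] at h1
    push_cast at h1 ⊢
    have p6 : -((k + 1) * (2 * a + (k + 1) + 1)) ≠ 0 := by
      have : 0 < (k + 1) * (2 * a + (k + 1) + 1) := by positivity
      exact neg_ne_zero.2 this.ne'
    refine mul_left_cancel₀ p6 ?_
    rw [← h1, pow_succ]
    generalize Real.Gamma (k + 1 + 2 * a + 1) = G at *
    field_simp
    ring

theorem phaseCos_eq_integral {m : ℝ → ℝ} (h : ∀ z, 1 < |z| → m z = 0) (θ t : ℝ) :
    phaseCos m θ t = ∫ z, m z * Real.cos (t * z + θ) := by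
  unfold phaseCos
  rw [intervalIntegral.integral_of_le (by norm_num), ← integral_Icc_eq_integral_Ioc]
  refine setIntegral_eq_integral_of_forall_compl_eq_zero fun z hz => ?_
  rw [h z (not_le.1 fun hz' => hz (abs_le.1 hz')), zero_mul]

theorem integral_conv_mul_cos {ρ g : ℝ → ℝ} (hρ : Integrable ρ) (hρe : ∀ t, ρ (-t) = ρ t)
    (hg : Integrable g) (ξ θ : ℝ) :
    ∫ z, (∫ t, ρ t * g (z - t)) * Real.cos (ξ * z + θ) =
      (∫ t, ρ t * Real.cos (ξ * t)) * ∫ u, g u * Real.cos (ξ * u + θ) := by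
  have hI : Integrable (Function.uncurry fun z t => ρ t * g (z - t) * Real.cos (ξ * z + θ))
      (volume.prod volume) := by
    have := (hρ.convolution_integrand (ContinuousLinearMap.lsmul ℝ ℝ) hg).mul_bdd (c := 1)
      (g := fun p : ℝ × ℝ => Real.cos (ξ * p.1 + θ))
      (Continuous.aestronglyMeasurable (by fun_prop))
      (Eventually.of_forall fun p => Real.abs_cos_le_one _)
    exact this
  have hb : ∀ {m : ℝ → ℝ}, Integrable m → ∀ {c : ℝ → ℝ}, Continuous c → (∀ z, |c z| ≤ 1) →
      Integrable fun z => m z * c z := fun hm c hc h1 =>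
    hm.mul_bdd (c := 1) hc.aestronglyMeasurable (Eventually.of_forall h1)
  have hs : ∫ t, ρ t * Real.sin (ξ * t) = 0 := by
    have h1 := integral_neg_eq_self (fun t => ρ t * Real.sin (ξ * t)) volume
    simp only [hρe, mul_neg, Real.sin_neg, integral_neg] at h1
    linarith
  have hinner : ∀ t, ∫ z, ρ t * g (z - t) * Real.cos (ξ * z + θ) =
      (∫ u, g u * Real.cos (ξ * u + θ)) * (ρ t * Real.cos (ξ * t)) -
        (∫ u, g u * Real.sin (ξ * u + θ)) * (ρ t * Real.sin (ξ * t)) := by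
    intro t
    have h1 := integral_sub_right_eq_self (μ := volume)
      (fun u => ρ t * g u * Real.cos (ξ * (u + t) + θ)) t
    simp only [sub_add_cancel] at h1
    rw [h1]
    have i1 : Integrable fun u => ρ t * Real.cos (ξ * t) * (g u * Real.cos (ξ * u + θ)) :=
      (hb hg (by fun_prop) fun z => Real.abs_cos_le_one _).const_mul _
    have i2 : Integrable fun u => ρ t * Real.sin (ξ * t) * (g u * Real.sin (ξ * u + θ)) :=
      (hb hg (by fun_prop) fun z => Real.abs_sin_le_one _).const_mul _
    have h2 : ∀ u, ρ t * g u * Real.cos (ξ * (u + t) + θ) =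
        ρ t * Real.cos (ξ * t) * (g u * Real.cos (ξ * u + θ)) -
          ρ t * Real.sin (ξ * t) * (g u * Real.sin (ξ * u + θ)) := fun u => by
      rw [show ξ * (u + t) + θ = (ξ * u + θ) + ξ * t by ring, Real.cos_add]
      ring
    simp only [h2]
    rw [integral_sub i1 i2, integral_const_mul, integral_const_mul]
    ring
  simp only [← integral_mul_const]
  rw [integral_integral_swap hI]
  simp only [hinner]
  have i1 : Integrable fun t => (∫ u, g u * Real.cos (ξ * u + θ)) * (ρ t * Real.cos (ξ * t)) :=
    (hb hρ (by fun_prop) fun z => Real.abs_cos_le_one _).const_mul _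
  have i2 : Integrable fun t => (∫ u, g u * Real.sin (ξ * u + θ)) * (ρ t * Real.sin (ξ * t)) :=
    (hb hρ (by fun_prop) fun z => Real.abs_sin_le_one _).const_mul _
  rw [integral_sub i1 i2, integral_const_mul, integral_const_mul, hs, mul_zero, sub_zero,
    integral_mul_const, mul_comm]

theorem exists_test_approx {f : ℝ → ℝ} (hf : Continuous f) (h0 : ∀ z, 1 < |z| → f z = 0) :
    ∃ F : ℕ → ℝ → ℝ, (∀ j, IsTest (F j)) ∧ (∃ M, ∀ j z, |F j z| ≤ M) ∧
      (∀ z, Tendsto (fun j => F j z) atTop (nhds (f z))) ∧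
      ∀ j, ∃ r ∈ Icc (1 / 3 : ℝ) 1, ∀ θ ξ, |phaseCos (F j) θ ξ| ≤ |phaseCos f θ (r * ξ)| := by
  obtain ⟨ε, hε, hε3, hεt⟩ : ∃ ε : ℕ → ℝ, (∀ j, 0 < ε j) ∧ (∀ j, ε j ≤ 1 / 3) ∧
      Tendsto ε atTop (nhds 0) := by
    refine ⟨fun j => 1 / ((j : ℝ) + 1) / 3, fun j => by positivity, fun j => ?_, ?_⟩
    · have : 1 / ((j : ℝ) + 1) ≤ 1 :=
        (div_le_one (by positivity)).2 (by linarith [j.cast_nonneg (α := ℝ)])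
      linarith
    · simpa using (tendsto_one_div_add_atTop_nhds_zero_nat (𝕜 := ℝ)).div_const 3
  let φ : ℕ → ContDiffBump (0 : ℝ) := fun j =>
    ⟨ε j / 2, ε j, half_pos (hε j), half_lt_self (hε j)⟩
  let ρ : ℕ → ℝ → ℝ := fun j => (φ j).normed volume
  let r : ℕ → ℝ := fun j => 1 - 2 * ε j
  have hr : ∀ j, r j ∈ Icc (1 / 3 : ℝ) 1 := fun j => by
    have h1 := hε j
    have h2 := hε3 j
    constructor <;> simp only [r] <;> linarith
  have hrp : ∀ j, 0 < r j := fun j => by linarith [(hr j).1]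
  let g : ℕ → ℝ → ℝ := fun j y => f (y / r j)
  have hgc : ∀ j, Continuous (g j) := fun j => hf.comp (continuous_id.div_const _)
  have hg0 : ∀ j z, r j < |z| → g j z = 0 := fun j z hz => by
    refine h0 _ ?_
    rw [abs_div, abs_of_pos (hrp j)]
    exact (one_lt_div (hrp j)).2 hz
  have hcs : ∀ j, HasCompactSupport (g j) := fun j =>
    HasCompactSupport.intro (isCompact_Icc (a := -r j) (b := r j)) fun z hz =>
      hg0 j z (not_le.1 fun h => hz (abs_le.1 h))
  have hρe : ∀ j t, ρ j (-t) = ρ j t := fun j t => (φ j).normed_neg (μ := volume) t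
  have hρi : ∀ j, Integrable (ρ j) := fun j => (φ j).integrable_normed
  have hρ0 : ∀ j t, 0 ≤ ρ j t := fun j t => (φ j).nonneg_normed t
  have hρ1 : ∀ j, ∫ t, ρ j t = 1 := fun j => (φ j).integral_normed
  have hρs : ∀ j t, ε j ≤ |t| → ρ j t = 0 := fun j t ht => by
    by_contra hne
    have h1 : t ∈ Function.support ((φ j).normed volume) := hne
    rw [(φ j).support_normed_eq] at h1
    simp only [Metric.mem_ball, dist_zero_right, Real.norm_eq_abs] at h1
    exact absurd h1 (not_lt.2 ht)
  obtain ⟨M, hM⟩ : ∃ M, ∀ z, |f z| ≤ M := by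
    have h1 : HasCompactSupport f :=
      HasCompactSupport.intro (isCompact_Icc (a := (-1 : ℝ)) (b := 1)) fun z hz =>
        h0 z (not_le.1 fun h => hz (abs_le.1 h))
    obtain ⟨M, hM⟩ := h1.exists_bound_of_continuous hf
    exact ⟨M, hM⟩
  let F : ℕ → ℝ → ℝ := fun j =>
    MeasureTheory.convolution (ρ j) (g j) (ContinuousLinearMap.lsmul ℝ ℝ) volume
  have hF : ∀ j z, F j z = ∫ t, ρ j t * g j (z - t) := fun j z => rfl
  have hF0 : ∀ j z, 1 - ε j < |z| → F j z = 0 := fun j z hz => by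
    rw [hF, ← integral_zero ℝ ℝ (μ := volume)]
    congr 1; ext t
    rcases le_or_gt (ε j) |t| with h | h
    · rw [hρs j t h, zero_mul]
    · rw [hg0 j (z - t), mul_zero]
      have h1 := abs_sub_abs_le_abs_sub z t
      simp only [r]
      linarith
  refine ⟨F, fun j => ⟨?_, 1 - ε j, by linarith [hε j], hF0 j⟩, ⟨M, fun j z => ?_⟩, fun z => ?_,
    fun j => ⟨r j, hr j, fun θ ξ => ?_⟩⟩
  · exact (φ j).hasCompactSupport_normed.contDiff_convolution_left _ (φ j).contDiff_normed
      (hgc j).locallyIntegrable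
  · rw [hF]
    have h1 := norm_integral_le_of_norm_le (μ := volume) ((hρi j).mul_const M)
      (f := fun t => ρ j t * g j (z - t)) (Eventually.of_forall fun t => by
        rw [norm_mul, Real.norm_of_nonneg (hρ0 j t)]
        exact mul_le_mul_of_nonneg_left (hM _) (hρ0 j t))
    rwa [integral_mul_const, hρ1, one_mul] at h1
  · refine ContDiffBump.convolution_tendsto_right (φ := φ) (g := g) (k := fun _ => z) hεt
      (Eventually.of_forall fun j => (hgc j).aestronglyMeasurable) ?_ tendsto_const_nhds
    have hrt : Tendsto r atTop (nhds 1) := by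
      simpa using (hεt.const_mul 2).const_sub 1
    have h1 : Tendsto (fun p : ℕ × ℝ => p.2 / r p.1) (atTop ×ˢ nhds z) (nhds (z / 1)) :=
      tendsto_snd.div (hrt.comp tendsto_fst) one_ne_zero
    rw [div_one] at h1
    exact (hf.tendsto z).comp h1
  · have hz : ∀ z, 1 < |z| → F j z = 0 := fun z hz => hF0 j z (by linarith [hε j])
    rw [phaseCos_eq_integral hz, phaseCos_eq_integral h0]
    simp only [hF]
    rw [integral_conv_mul_cos (hρi j) (hρe j) ((hgc j).integrable_of_hasCompactSupport (hcs j)),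
      abs_mul]
    have h1 : |∫ t, ρ j t * Real.cos (ξ * t)| ≤ 1 := by
      have h1 := norm_integral_le_of_norm_le (μ := volume) (hρi j)
        (f := fun t => ρ j t * Real.cos (ξ * t)) (Eventually.of_forall fun t => by
          rw [norm_mul, Real.norm_of_nonneg (hρ0 j t)]
          exact mul_le_of_le_one_right (hρ0 j t) (Real.abs_cos_le_one _))
      rwa [hρ1] at h1
    have h2 : ∫ u, g j u * Real.cos (ξ * u + θ) =
        r j * ∫ z, f z * Real.cos (r j * ξ * z + θ) := by
      have h3 := Measure.integral_comp_div (fun z => f z * Real.cos (r j * ξ * z + θ)) (r j)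
      rw [abs_of_pos (hrp j), smul_eq_mul] at h3
      rw [← h3]
      congr 1; ext u
      simp only [g]
      congr 3
      field_simp [(hrp j).ne']
    rw [h2, abs_mul, abs_of_pos (hrp j)]
    calc _ ≤ 1 * (1 * |∫ z, f z * Real.cos (r j * ξ * z + θ)|) :=
          mul_le_mul h1 (mul_le_mul_of_nonneg_right (hr j).2 (abs_nonneg _))
            (mul_nonneg (hrp j).le (abs_nonneg _)) zero_le_one
      _ = _ := by ring

theorem abs_moment_integrand_le {a μ C ξ y : ℝ} (ha : 0 ≤ a) (k : ℕ) (hξ : 0 < ξ)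
    (hy : |y| ≤ C * ξ ^ (μ - a - 1)) :
    |ξ ^ (2 * a + k) * (poissonCos (a + k) ξ * y)| ≤
      C * (2 ^ (a + k) * Real.Gamma (a + k + 1)) * (ξ ^ (μ - 2) * |riccatiBessel (a + k) ξ|) := by
  have hb : 0 ≤ a + k := by positivity
  have hD := riccatiBessel_const_pos hb
  unfold riccatiBessel
  rw [abs_mul, abs_mul, abs_div, abs_mul, abs_of_pos hD, abs_of_pos (Real.rpow_pos_of_pos hξ _),
    abs_of_pos (Real.rpow_pos_of_pos hξ _)]
  have h1 : ξ ^ (2 * a + k) * ξ ^ (μ - a - 1) = ξ ^ (μ - 2) * ξ ^ (a + k + 1) := by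
    rw [← Real.rpow_add hξ, ← Real.rpow_add hξ]
    congr 1; ring
  calc ξ ^ (2 * a + k) * (|poissonCos (a + k) ξ| * |y|)
      ≤ ξ ^ (2 * a + k) * (|poissonCos (a + k) ξ| * (C * ξ ^ (μ - a - 1))) := by gcongr
    _ = C * |poissonCos (a + k) ξ| * (ξ ^ (2 * a + k) * ξ ^ (μ - a - 1)) := by ring
    _ = _ := by
      rw [h1]
      field_simp

theorem abs_jacobiMoment_le {a μ C : ℝ} (ha : 1 / 2 ≤ a) (hμ0 : 0 ≤ μ) (hμ : μ < 1 / 2) (k : ℕ)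
    {g : ℝ → ℝ} (hC : ∀ ξ, 0 < ξ → |phaseCos g (k * (Real.pi / 2)) ξ| ≤ C * ξ ^ (μ - a - 1)) :
    |jacobiMoment a k g| ≤ C * (2 ^ (a + k) * Real.Gamma (a + k + 1)) *
      ∫ ξ in Ioi 0, ξ ^ (μ - 2) * |riccatiBessel (a + k) ξ| := by
  have ha0 : 0 ≤ a := by linarith
  have hb : 1 / 2 ≤ a + k := by linarith [k.cast_nonneg (α := ℝ)]
  rw [← integral_const_mul]
  rw [← Real.norm_eq_abs, jacobiMoment, besselMoment]
  refine norm_integral_le_of_norm_le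
    ((integrableOn_rpow_mul_riccatiBessel hb hμ0 hμ).const_mul _)
    ((ae_restrict_iff' measurableSet_Ioi).2 (Eventually.of_forall fun ξ hξ => ?_))
  exact abs_moment_integrand_le ha0 k hξ (hC ξ hξ)

theorem jacobiMoment_eq_of_decay {f₀ : ℝ → ℝ} (hf₀ : IsTest f₀)
    (hf₁ : ∫ z in (-1 : ℝ)..1, f₀ z = 1) {a μ C : ℝ} (ha : 1 / 2 ≤ a) (hμ0 : 0 ≤ μ)
    (hμ : μ < 1 / 2) (k : ℕ) {g : ℝ → ℝ} (hg : Continuous g) (h0 : ∀ z, 1 < |z| → g z = 0)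
    (hC : ∀ ξ, 0 < ξ → |phaseCos g (k * (Real.pi / 2)) ξ| ≤ C * ξ ^ (μ - a - 1)) :
    jacobiMoment a k g = (-2) ^ k * Real.Gamma (k + 2 * a + 1) / Real.Gamma (2 * a + 1) *
      jacobiMoment a 0 f₀ * ∫ z in (-1 : ℝ)..1, g z * jacobiP a a k z := by
  obtain ⟨F, hF, ⟨M, hM⟩, hlim, hle⟩ := exists_test_approx hg h0
  have hb : 1 / 2 ≤ a + k := by linarith [k.cast_nonneg (α := ℝ)]
  have hC0 : 0 ≤ C := by
    have := (abs_nonneg _).trans (hC 1 one_pos)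
    simpa using this
  have hdom : ∀ {c : ℝ → ℝ}, Continuous c →
      Tendsto (fun j => ∫ z in (-1 : ℝ)..1, F j z * c z) atTop
        (nhds (∫ z in (-1 : ℝ)..1, g z * c z)) := by
    intro c hc
    refine intervalIntegral.tendsto_integral_filter_of_dominated_convergence
      (fun z => M * |c z|) (Eventually.of_forall fun j =>
        ((hF j).continuous.mul hc).aestronglyMeasurable) ?_
      ((continuous_const.mul hc.abs).intervalIntegrable _ _) ?_
    · refine Eventually.of_forall fun j => Eventually.of_forall fun z _ => ?_
      rw [norm_mul]
      exact mul_le_mul_of_nonneg_right (hM j z) (abs_nonneg _)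
    · exact Eventually.of_forall fun z _ => (hlim z).mul_const _
  have hm : Tendsto (fun j => jacobiMoment a k (F j)) atTop (nhds (jacobiMoment a k g)) := by
    refine tendsto_integral_filter_of_dominated_convergence
      (fun ξ => C * (1 / 3 : ℝ) ^ (μ - a - 1) * (2 ^ (a + k) * Real.Gamma (a + k + 1)) *
        (ξ ^ (μ - 2) * |riccatiBessel (a + k) ξ|)) (Eventually.of_forall fun j => ?_)
      (Eventually.of_forall fun j => ?_)
      ((integrableOn_rpow_mul_riccatiBessel hb hμ0 hμ).const_mul _) ?_
    · have h1 : Continuous (phaseCos (F j) (k * (Real.pi / 2))) :=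
        continuous_iff_continuousAt.2 fun t =>
          (phaseCos_hasDerivAt (hF j).continuous _ t).continuousAt
      exact ((Real.continuous_rpow_const (by positivity)).mul
        ((continuous_poissonCos (by linarith)).mul h1)).aestronglyMeasurable
    · obtain ⟨r, hr, hr'⟩ := hle j
      have hr0 : 0 < r := by linarith [hr.1]
      refine (ae_restrict_iff' measurableSet_Ioi).2 (Eventually.of_forall fun ξ hξ => ?_)
      have hξ : 0 < ξ := hξ
      have ha0 : 0 ≤ a := by linarith
      refine abs_moment_integrand_le ha0 k hξ
        ((hr' _ _).trans ((hC _ (mul_pos hr0 hξ)).trans ?_))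
      rw [Real.mul_rpow hr0.le hξ.le, ← mul_assoc]
      refine mul_le_mul_of_nonneg_right (mul_le_mul_of_nonneg_left ?_ hC0) (by positivity)
      exact Real.rpow_le_rpow_of_nonpos (by norm_num) hr.1 (by linarith)
    · refine Eventually.of_forall fun ξ => ?_
      exact ((hdom (by fun_prop)).const_mul _).const_mul _
  refine tendsto_nhds_unique hm ?_
  have h1 := (hdom (continuous_jacobiP a a k)).const_mul
    ((-2) ^ k * Real.Gamma (k + 2 * a + 1) / Real.Gamma (2 * a + 1) * jacobiMoment a 0 f₀)
  refine h1.congr fun j => ?_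
  rw [IsTest.jacobiMoment_eq hf₀ hf₁ k (by linarith) (hF j)]

theorem exists_isTest_integral_eq_one : ∃ f : ℝ → ℝ, IsTest f ∧ ∫ z in (-1 : ℝ)..1, f z = 1 := by
  let φ : ContDiffBump (0 : ℝ) := ⟨1 / 4, 1 / 2, by norm_num, by norm_num⟩
  have h0 : ∀ z, 1 / 2 < |z| → φ.normed volume z = 0 := fun t ht => by
    by_contra hne
    have h1 : t ∈ Function.support (φ.normed volume) := hne
    rw [φ.support_normed_eq] at h1
    simp only [Metric.mem_ball, dist_zero_right, Real.norm_eq_abs] at h1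
    exact absurd h1 (not_lt.2 ht.le)
  refine ⟨φ.normed volume, ⟨φ.contDiff_normed, 1 / 2, by norm_num, h0⟩, ?_⟩
  have h1 := phaseCos_eq_integral (m := φ.normed volume) (fun z hz => h0 z (by linarith)) 0 0
  simp only [phaseCos, zero_mul, add_zero, Real.cos_zero, mul_one] at h1
  rw [h1, φ.integral_normed]

theorem exists_abs_poissonCos_le {a : ℝ} (ha : 0 ≤ a) :
    ∃ C, ∀ ξ, 0 < ξ → |poissonCos a ξ| ≤ C * ξ ^ (0 - a - 1) := by
  obtain ⟨A, hA, hA'⟩ := exists_besselEnergy_le ha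
  have hD := riccatiBessel_const_pos ha
  set D := 2 ^ a * Real.Gamma (a + 1) with hDdef
  set T := 2 * (a * (a + 1)) + 1 with hT
  have hT1 : 1 ≤ T := by rw [hT]; nlinarith
  refine ⟨2 * T ^ (a + 1) + D * (1 + 2 * A), fun ξ hξ => ?_⟩
  have hp : 0 < ξ ^ (a + 1) := Real.rpow_pos_of_pos hξ _
  rw [show (0 - a - 1 : ℝ) = -(a + 1) by ring, Real.rpow_neg hξ.le, ← div_eq_mul_inv, le_div_iff₀ hp]
  have hT0 : 0 ≤ 2 * T ^ (a + 1) := by positivity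
  have hD0 : 0 ≤ D * (1 + 2 * A) := by positivity
  rcases le_total ξ T with h | h
  · calc |poissonCos a ξ| * ξ ^ (a + 1) ≤ 2 * T ^ (a + 1) := by
          gcongr
          exact abs_poissonCos_le ha ξ
      _ ≤ _ := by linarith
  · have h1 := sq_riccatiBessel_le (b := a) hξ (by nlinarith)
    have h2 : riccatiBessel a ξ = ξ ^ (a + 1) * poissonCos a ξ / D := rfl
    have h3 : |poissonCos a ξ| * ξ ^ (a + 1) = D * |riccatiBessel a ξ| := by
      rw [h2, abs_div, abs_mul, abs_of_pos hD, abs_of_pos hp]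
      field_simp
    have h4 : |riccatiBessel a ξ| ≤ 1 + 2 * A := by
      have h5 := hA' ξ hξ
      have h6 := sq_abs (riccatiBessel a ξ)
      nlinarith [sq_nonneg (|riccatiBessel a ξ| - 1)]
    rw [h3]
    have := mul_le_mul_of_nonneg_left h4 hD.le
    linarith

theorem jacobiMoment_zero_ne_zero {f₀ : ℝ → ℝ} (hf₀ : IsTest f₀)
    (hf₁ : ∫ z in (-1 : ℝ)..1, f₀ z = 1) {a : ℝ} (ha : 1 / 2 ≤ a) : jacobiMoment a 0 f₀ ≠ 0 := by
  intro hK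
  have ha0 : 0 ≤ a := by linarith
  have hap : 0 < a := by linarith
  obtain ⟨C, hC⟩ := exists_abs_poissonCos_le ha0
  let w : ℝ → ℝ := fun z => (max (1 - z ^ 2) 0) ^ a
  have hw : Continuous w := (Continuous.max (by fun_prop) continuous_const).rpow_const
    fun _ => Or.inr ha0
  have hw0 : ∀ z, 1 < |z| → w z = 0 := fun z hz => by
    have : 1 - z ^ 2 ≤ 0 := by
      rw [← sq_abs]
      nlinarith
    simp only [w, max_eq_right this, Real.zero_rpow hap.ne']
  have hwj : ∀ ξ, phaseCos w ((0 : ℕ) * (Real.pi / 2)) ξ = poissonCos a ξ := fun ξ => by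
    rw [Nat.cast_zero, zero_mul]
    refine phaseCos_congr (fun z hz => ?_) _ _
    have : 0 ≤ 1 - z ^ 2 := by nlinarith [hz.1, hz.2]
    simp only [w, max_eq_left this]
  have h1 := jacobiMoment_eq_of_decay hf₀ hf₁ ha le_rfl (by norm_num) 0 hw hw0 (C := C)
    fun ξ hξ => by rw [hwj]; exact hC ξ hξ
  rw [hK] at h1
  simp only [mul_zero, zero_mul] at h1
  unfold jacobiMoment besselMoment at h1
  simp only [hwj] at h1
  simp only [Nat.cast_zero, add_zero] at h1
  have hi : IntegrableOn (fun ξ => ξ ^ (2 * a) * (poissonCos a ξ * poissonCos a ξ)) (Ioi 0) := by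
    refine Integrable.mono' ((integrableOn_rpow_mul_riccatiBessel ha le_rfl
      (by norm_num)).const_mul (C * (2 ^ a * Real.Gamma (a + 1)))) ?_
      ((ae_restrict_iff' measurableSet_Ioi).2 (Eventually.of_forall fun ξ hξ => ?_))
    · exact ((Real.continuous_rpow_const (by positivity)).mul
        ((continuous_poissonCos ha0).mul (continuous_poissonCos ha0))).aestronglyMeasurable
    · have := abs_moment_integrand_le ha0 0 hξ (hC ξ hξ)
      simpa only [Nat.cast_zero, add_zero, Real.norm_eq_abs] using this
  obtain ⟨δ, hδ, hδ'⟩ : ∃ δ > 0, ∀ ξ, |ξ| < δ → 0 < poissonCos a ξ := by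
    have h2 := (continuous_poissonCos ha0).continuousAt.eventually
      (lt_mem_nhds (poissonCos_zero_pos ha0))
    obtain ⟨δ, hδ, h⟩ := Metric.eventually_nhds_iff.1 h2
    exact ⟨δ, hδ, fun ξ hξ => h (by simpa using hξ)⟩
  have hpos : 0 < ∫ ξ in (0 : ℝ)..δ, ξ ^ (2 * a) * (poissonCos a ξ * poissonCos a ξ) := by
    refine intervalIntegral.intervalIntegral_pos_of_pos_on ?_ (fun ξ hξ => ?_) hδ
    · rw [intervalIntegrable_iff_integrableOn_Ioc_of_le hδ.le]
      exact hi.mono_set Ioc_subset_Ioi_self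
    · have := hδ' ξ (by rw [abs_of_pos hξ.1]; exact hξ.2)
      have := hξ.1
      positivity
  rw [intervalIntegral.integral_of_le hδ.le] at hpos
  have hle := setIntegral_mono_set hi ((ae_restrict_iff' measurableSet_Ioi).2
    (Eventually.of_forall fun ξ hξ =>
      mul_nonneg (Real.rpow_nonneg (le_of_lt hξ) _) (mul_self_nonneg _)))
    (Ioc_subset_Ioi_self (a := δ) (b := 0)).eventuallyLE
  linarith

theorem abs_phaseCos_nat_mul_pi (m : ℝ → ℝ) (n : ℕ) (t : ℝ) :
    |phaseCos m (n * Real.pi) t| = |phaseCos m 0 t| := by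
  induction n with
  | zero => simp
  | succ n ih =>
    rw [Nat.cast_succ, add_mul, one_mul, phaseCos_add_pi, abs_neg, ih]

theorem exists_abs_integral_mul_jacobiP_le {a μ : ℝ} (ha : 1 / 2 ≤ a) (hμ0 : 0 ≤ μ)
    (hμ : μ < 1 / 2) :
    ∃ B, 0 < B ∧ ∀ (g : ℝ → ℝ) (C : ℝ), Continuous g → (∀ z, 1 < |z| → g z = 0) →
      (∀ ξ, 0 < ξ → |phaseCos g 0 ξ| ≤ C * ξ ^ (μ - a - 1)) → ∀ n : ℕ, 1 ≤ n →
      |∫ z in (-1 : ℝ)..1, g z * jacobiP a a (2 * n) z| ≤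
        B * C * (Real.Gamma ((2 * n : ℕ) + a + 1) / Real.Gamma ((2 * n : ℕ) + 2 * a + 1)) *
          ((2 * n : ℕ) : ℝ) ^ (μ - 1) := by
  obtain ⟨f₀, hf₀, hf₁⟩ := exists_isTest_integral_eq_one
  have hK := jacobiMoment_zero_ne_zero hf₀ hf₁ ha
  obtain ⟨A, hA, hA'⟩ := exists_integral_rpow_mul_riccatiBessel_le ha hμ0 hμ
  have hG : 0 < Real.Gamma (2 * a + 1) := Real.Gamma_pos_of_pos (by linarith)
  refine ⟨2 ^ a * Real.Gamma (2 * a + 1) * A / |jacobiMoment a 0 f₀|, by positivity,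
    fun g C hg h0 hC n hn => ?_⟩
  have hC0 : 0 ≤ C := by
    have := (abs_nonneg _).trans (hC 1 one_pos)
    simpa using this
  have hC' : ∀ ξ, 0 < ξ → |phaseCos g ((2 * n : ℕ) * (Real.pi / 2)) ξ| ≤ C * ξ ^ (μ - a - 1) := by
    intro ξ hξ
    rw [show ((2 * n : ℕ) : ℝ) * (Real.pi / 2) = n * Real.pi by push_cast; ring,
      abs_phaseCos_nat_mul_pi]
    exact hC ξ hξ
  have h1 := jacobiMoment_eq_of_decay hf₀ hf₁ ha hμ0 hμ (2 * n) hg h0 hC'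
  have h2 := abs_jacobiMoment_le ha hμ0 hμ (2 * n) hC'
  have h3 := hA' (2 * n) (by omega)
  generalize 2 * n = k at *
  have hk : (0 : ℝ) ≤ k := k.cast_nonneg
  have hG1 : 0 < Real.Gamma (k + 2 * a + 1) := Real.Gamma_pos_of_pos (by linarith)
  have hG2 : 0 < Real.Gamma (a + k + 1) := Real.Gamma_pos_of_pos (by linarith)
  rw [h1, abs_mul, abs_mul, abs_div, abs_mul, abs_pow, abs_neg, abs_of_pos (zero_lt_two' ℝ),
    abs_of_pos hG, abs_of_pos hG1] at h2
  have h4 := h2.trans (mul_le_mul_of_nonneg_left h3 (by positivity))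
  rw [Real.rpow_add_natCast (by norm_num)] at h4
  rw [show (k : ℝ) + a + 1 = a + k + 1 by ring]
  have hKp : 0 < |jacobiMoment a 0 f₀| := abs_pos.2 hK
  set J := |∫ z in (-1 : ℝ)..1, g z * jacobiP a a k z|
  have h5 : 2 ^ k * Real.Gamma (k + 2 * a + 1) * |jacobiMoment a 0 f₀| / Real.Gamma (2 * a + 1) * J
      ≤ 2 ^ k * Real.Gamma (k + 2 * a + 1) * |jacobiMoment a 0 f₀| / Real.Gamma (2 * a + 1) *
        (2 ^ a * Real.Gamma (2 * a + 1) * A / |jacobiMoment a 0 f₀| * C *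
          (Real.Gamma (a + k + 1) / Real.Gamma (k + 2 * a + 1)) * (k : ℝ) ^ (μ - 1)) := by
    refine (le_of_eq ?_).trans (h4.trans (le_of_eq ?_))
    · ring
    · field_simp
  exact le_of_mul_le_mul_left h5 (by positivity)

theorem factorial_mul_rpow_le_Gamma {a : ℝ} (ha : 0 < a) {k : ℕ} (hk : 1 ≤ k) :
    k.factorial * (k : ℝ) ^ a ≤ Real.Gamma (k + a + 1) := by
  have hk0 : (0 : ℝ) < k := by exact_mod_cast hk
  have h1 := Real.convexOn_log_Gamma.slope_mono_adjacent (x := (k : ℝ)) (y := k + 1)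
    (z := k + a + 1) hk0 (show (0 : ℝ) < k + a + 1 by linarith) (by linarith) (by linarith)
  have hG : 0 < Real.Gamma (k + a + 1) := Real.Gamma_pos_of_pos (by linarith)
  have hGk : 0 < Real.Gamma k := Real.Gamma_pos_of_pos hk0
  simp only [Function.comp] at h1
  rw [Real.Gamma_add_one hk0.ne', Real.log_mul hk0.ne' hGk.ne', show (k : ℝ) + 1 - k = 1 by ring,
    show (k : ℝ) + a + 1 - (k + 1) = a by ring, div_one, add_sub_cancel_right, le_div_iff₀ ha] at h1
  rw [← Real.Gamma_nat_eq_factorial, Real.Gamma_add_one hk0.ne',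
    ← Real.log_le_log_iff (by positivity) hG, Real.log_mul (by positivity) (by positivity),
    Real.log_mul hk0.ne' hGk.ne', Real.log_rpow hk0]
  linarith

theorem fourierT_eq_integral_cos {f : ℝ → ℂ} (hf : Integrable f) (he : ∀ t, f (-t) = f t)
    (η : ℝ) : fourierT f η = ∫ t, Real.cos (η * t) • f t := by
  have hi : ∀ c : ℝ, Integrable fun t : ℝ => f t * Complex.exp (Complex.I * c * t) := fun c =>
    hf.mul_bdd (c := 1) (g := fun t : ℝ => Complex.exp (Complex.I * c * t)) (Continuous.aestronglyMeasurable (by fun_prop))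
      (Eventually.of_forall fun t => by
        rw [Complex.norm_exp]
        simp)
  have h1 := integral_neg_eq_self (fun t : ℝ => f t * Complex.exp (-Complex.I * η * t)) volume
  have h2 : fourierT f η = ∫ t : ℝ, f t * Complex.exp (Complex.I * η * t) := by
    rw [fourierT, ← h1]
    congr 1; ext t
    rw [he, Complex.ofReal_neg, neg_mul, neg_mul_neg]
  have h3 : fourierT f η = ∫ t : ℝ, f t * Complex.exp (Complex.I * (-η : ℝ) * t) := by
    rw [fourierT]
    congr 1; ext t
    push_cast
    ring_nf
  have h4 : fourierT f η + fourierT f η = 2 * ∫ t, Real.cos (η * t) • f t := by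
    nth_rewrite 1 [h2]
    rw [h3, ← integral_add (hi η) (hi (-η)), ← integral_const_mul]
    congr 1; ext t
    rw [Complex.real_smul, Complex.ofReal_cos, Complex.cos]
    push_cast
    ring_nf
  linear_combination h4 / 2

theorem abs_phaseCos_comp_le {f : ℝ → ℂ} (hf : Integrable f) (he : ∀ t, f (-t) = f t) {x : ℝ}
    (hx : 0 < x) (hs : ∀ t ∉ Icc (-x) x, f t = 0) (L : ℂ →L[ℝ] ℝ) (hL : ∀ z, |L z| ≤ ‖z‖)
    (ξ : ℝ) : |phaseCos (fun z => L (f (x * z))) 0 ξ| ≤ ‖fourierT f (ξ / x)‖ / x := by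
  have h0 : ∀ z, 1 < |z| → L (f (x * z)) = 0 := fun z hz => by
    rw [hs, map_zero]
    intro h
    have := abs_le.2 h
    rw [abs_mul, abs_of_pos hx] at this
    nlinarith
  have hi : Integrable fun z => Real.cos (ξ * z) • f (x * z) :=
    (hf.comp_mul_left' hx.ne').bdd_smul 1
      (Real.continuous_cos.comp (continuous_const.mul continuous_id)).aestronglyMeasurable
      (Eventually.of_forall fun t => Real.abs_cos_le_one _)
  have h1 := Measure.integral_comp_mul_left (fun t => Real.cos (ξ / x * t) • f t) x
  have h2 : ∫ z, Real.cos (ξ * z) • f (x * z) = x⁻¹ • fourierT f (ξ / x) := by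
    rw [fourierT_eq_integral_cos hf he, ← abs_of_pos (inv_pos.2 hx), ← h1]
    congr 1; ext z
    rw [show ξ / x * (x * z) = ξ * z by field_simp]
  have h3 : phaseCos (fun z => L (f (x * z))) 0 ξ = L (∫ z, Real.cos (ξ * z) • f (x * z)) := by
    rw [phaseCos_eq_integral h0, ← L.integral_comp_comm hi]
    congr 1; ext z
    rw [map_smul, smul_eq_mul, add_zero, mul_comm]
  rw [h3, h2]
  refine (hL _).trans (le_of_eq ?_)
  rw [norm_smul, Real.norm_of_nonneg (inv_pos.2 hx).le, inv_mul_eq_div]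

theorem jacobiNormSq_pos {l : ℝ} (hl : -(1 / 2 : ℝ) ≤ l) (k : ℕ) : 0 < jacobiNormSq l k := by
  have hk : (0 : ℝ) ≤ k := k.cast_nonneg
  have h1 : 0 < 2 * (k : ℝ) + 2 * l + 3 := by linarith
  have h2 : 0 < Real.Gamma ((k : ℝ) + l + 2) := Real.Gamma_pos_of_pos (by linarith)
  have h3 : 0 < Real.Gamma ((k : ℝ) + 2 * l + 3) := Real.Gamma_pos_of_pos (by linarith)
  unfold jacobiNormSq
  positivity

theorem norm_betaT_eq {l x : ℝ} (hl : -(1 / 2 : ℝ) ≤ l) (hx : 0 < x) (f : ℝ → ℂ) (n : ℕ) :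
    ‖betaT l x f n‖ = x * ‖∫ z in (-1 : ℝ)..1, jacobiP (l + 1) (l + 1) (2 * n) z • f (x * z)‖ /
      jacobiNormSq l (2 * n) := by
  have hh := jacobiNormSq_pos hl (2 * n)
  have h1 : cJ l x f (2 * n) = (∫ z in (-1 : ℝ)..1,
      jacobiP (l + 1) (l + 1) (2 * n) z • f (x * z)) / (√(jacobiNormSq l (2 * n)) : ℝ) := by
    rw [intervalIntegral.integral_of_le (by norm_num), integral_Ioc_eq_integral_Ioo,
      ← integral_div, cJ]
    refine setIntegral_congr_fun measurableSet_Ioo fun z hz => ?_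
    have h2 : (0 : ℝ) < 1 - z ^ 2 := by nlinarith [hz.1, hz.2]
    have h3 : (((1 - z ^ 2) ^ (l + 1) : ℝ) : ℂ) ≠ 0 :=
      Complex.ofReal_ne_zero.2 (Real.rpow_pos_of_pos h2 _).ne'
    simp only [jacobiPNorm, Complex.real_smul]
    rw [Complex.ofReal_mul, Complex.ofReal_div]
    field_simp
  have h2 : √(jacobiNormSq l (2 * n)) * √(jacobiNormSq l (2 * n)) = jacobiNormSq l (2 * n) :=
    Real.mul_self_sqrt hh.le
  rw [betaT, h1, norm_div, norm_mul, norm_div, Complex.norm_real, Complex.norm_real,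
    Real.norm_of_nonneg hx.le, Real.norm_of_nonneg (Real.sqrt_nonneg _), mul_div_assoc, div_div, h2,
    mul_div_assoc]

theorem sum_range_rpow_le {s : ℝ} (hs : 0 < s) {N : ℕ} (hN : 1 ≤ N) (n : ℕ) :
    ∑ i ∈ Finset.range n, ((N : ℝ) + 1 + i) ^ (-s - 1) ≤ s⁻¹ * (N : ℝ) ^ (-s) := by
  have hN0 : (0 : ℝ) < N := by exact_mod_cast hN
  have hn0 : (0 : ℝ) ≤ n := n.cast_nonneg
  have h1 : AntitoneOn (fun t : ℝ => t ^ (-s - 1)) (Icc (N : ℝ) (N + n)) := fun y hy z _ hyz =>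
    Real.rpow_le_rpow_of_nonpos (hN0.trans_le hy.1) hyz (by linarith)
  have h2 := h1.sum_le_integral
  rw [integral_rpow (Or.inr ⟨by linarith, by
    rw [uIcc_of_le (by linarith)]
    exact fun h => absurd h.1 (not_le.2 hN0)⟩), show -s - 1 + 1 = -s by ring] at h2
  have h3 : 0 ≤ ((N : ℝ) + n) ^ (-s) := by positivity
  calc ∑ i ∈ Finset.range n, ((N : ℝ) + 1 + i) ^ (-s - 1)
      = ∑ i ∈ Finset.range n, ((N : ℝ) + (i + 1 : ℕ)) ^ (-s - 1) :=
        Finset.sum_congr rfl fun i _ => by rw [Nat.cast_succ, add_assoc, add_comm 1 (i : ℝ)]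
    _ ≤ _ := h2
    _ = s⁻¹ * (N : ℝ) ^ (-s) - s⁻¹ * ((N : ℝ) + n) ^ (-s) := by
      field_simp
      ring
    _ ≤ _ := by
      have := mul_nonneg (inv_pos.2 hs).le h3
      linarith

theorem exists_norm_betaT_le {l μ x : ℝ} (hl : -(1 / 2 : ℝ) ≤ l) (hμ0 : 0 ≤ μ) (hμ : μ < 1 / 2)
    (hx : 0 < x) {f : ℝ → ℂ} (hfc : Continuous f) (hfi : Integrable f)
    (heven : ∀ t : ℝ, f (-t) = f t) (hsupp : ∀ t : ℝ, t ∉ Icc (-x) x → f t = 0)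
    {C₀ : ℝ} (hC₀ : 0 < C₀) (hFT : ∀ ξ : ℝ, ξ ≠ 0 → ‖fourierT f ξ‖ ≤ C₀ / |ξ| ^ (l - μ + 2)) :
    ∃ D, 0 < D ∧ ∀ n : ℕ, 1 ≤ n → ‖betaT l x f n‖ ≤ D * (n : ℝ) ^ (μ - (l + 1)) := by
  obtain ⟨a, rfl⟩ : ∃ a, l = a - 1 := ⟨l + 1, by ring⟩
  have ha : 1 / 2 ≤ a := by linarith
  obtain ⟨B, hB, hB'⟩ := exists_abs_integral_mul_jacobiP_le ha hμ0 hμ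
  set C := C₀ * x ^ (a - μ) with hC
  have hCp : 0 < C := by positivity
  have h0 : ∀ z, 1 < |z| → f (x * z) = 0 := fun z hz => hsupp _ fun h => by
    have := abs_le.2 h
    rw [abs_mul, abs_of_pos hx] at this
    nlinarith
  have hdec : ∀ ξ, 0 < ξ → ‖fourierT f (ξ / x)‖ / x ≤ C * ξ ^ (μ - a - 1) := fun ξ hξ => by
    have h1 := hFT (ξ / x) (by positivity)
    rw [abs_of_pos (by positivity), Real.div_rpow hξ.le hx.le] at h1
    refine (div_le_div_of_nonneg_right h1 hx.le).trans (le_of_eq ?_)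
    rw [hC, show μ - a - 1 = -(a - 1 - μ + 2) by ring, Real.rpow_neg hξ.le,
      show a - 1 - μ + 2 = (a - μ) + 1 by ring, Real.rpow_add_one hx.ne']
    field_simp
  have hcomp : ∀ L : ℂ →L[ℝ] ℝ, (∀ z, |L z| ≤ ‖z‖) → ∀ n : ℕ, 1 ≤ n →
      |L (∫ z in (-1 : ℝ)..1, jacobiP a a (2 * n) z • f (x * z))| ≤
        B * C * (Real.Gamma ((2 * n : ℕ) + a + 1) / Real.Gamma ((2 * n : ℕ) + 2 * a + 1)) *
          ((2 * n : ℕ) : ℝ) ^ (μ - 1) := by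
    intro L hL n hn
    have h1 := hB' (fun z => L (f (x * z))) C (by fun_prop) (fun z hz => by rw [h0 z hz, map_zero])
      (fun ξ hξ => (abs_phaseCos_comp_le hfi heven hx hsupp L hL ξ).trans (hdec ξ hξ)) n hn
    have h2 : Continuous fun z => jacobiP a a (2 * n) z • f (x * z) :=
      (continuous_jacobiP a a (2 * n)).smul (by fun_prop)
    rw [← L.intervalIntegral_comp_comm (h2.intervalIntegrable _ _)]
    simp only [map_smul, smul_eq_mul]
    simpa only [mul_comm] using h1
  refine ⟨x * (2 * (B * C)) * (2 * a + 3) / 2 ^ (2 * a + 1), by positivity, fun n hn => ?_⟩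
  rw [norm_betaT_eq hl hx]
  set I := ∫ z in (-1 : ℝ)..1, jacobiP (a - 1 + 1) (a - 1 + 1) (2 * n) z • f (x * z) with hI
  rw [sub_add_cancel] at hI
  have hn0 : (0 : ℝ) < n := by exact_mod_cast hn
  have hIle : ‖I‖ ≤ 2 * (B * C * (Real.Gamma ((2 * n : ℕ) + a + 1) /
      Real.Gamma ((2 * n : ℕ) + 2 * a + 1)) * ((2 * n : ℕ) : ℝ) ^ (μ - 1)) := by
    have h1 := hcomp Complex.reCLM Complex.abs_re_le_norm n hn
    have h2 := hcomp Complex.imCLM Complex.abs_im_le_norm n hn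
    rw [← hI] at h1 h2
    have h3 := Complex.norm_le_abs_re_add_abs_im I
    simp only [Complex.reCLM_apply, Complex.imCLM_apply] at h1 h2
    linarith
  have hk1 : 1 ≤ 2 * n := by omega
  have hGk := factorial_mul_rpow_le_Gamma (a := a) (by linarith) hk1
  have hkn : (n : ℝ) ≤ (2 * n : ℕ) := by push_cast; linarith
  unfold jacobiNormSq
  generalize 2 * n = k at *
  have hk : (1 : ℝ) ≤ k := by exact_mod_cast hk1
  have hk0 : (0 : ℝ) < k := by linarith
  rw [show 2 * (a - 1) + 3 = 2 * a + 1 by ring, show (k : ℝ) + (a - 1) + 2 = k + a + 1 by ring,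
    show 2 * (k : ℝ) + 2 * (a - 1) + 3 = 2 * k + 2 * a + 1 by ring,
    show (k : ℝ) + 2 * (a - 1) + 3 = k + 2 * a + 1 by ring, show a - 1 + 1 = a by ring]
  have hG1 : 0 < Real.Gamma (k + 2 * a + 1) := Real.Gamma_pos_of_pos (by linarith)
  have hG2 : 0 < Real.Gamma (k + a + 1) := Real.Gamma_pos_of_pos (by linarith)
  have hq : 0 < 2 * (k : ℝ) + 2 * a + 1 := by linarith
  have hfac : (0 : ℝ) < k.factorial := by exact_mod_cast k.factorial_pos
  set G1 := Real.Gamma (k + 2 * a + 1)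
  set G2 := Real.Gamma (k + a + 1)
  calc x * ‖I‖ / (2 ^ (2 * a + 1) / (2 * k + 2 * a + 1) * G2 ^ 2 / (k.factorial * G1))
      ≤ x * (2 * (B * C * (G2 / G1) * (k : ℝ) ^ (μ - 1))) /
          (2 ^ (2 * a + 1) / (2 * k + 2 * a + 1) * G2 ^ 2 / (k.factorial * G1)) := by gcongr
    _ = x * (2 * (B * C)) / 2 ^ (2 * a + 1) * (k : ℝ) ^ (μ - 1) * (2 * k + 2 * a + 1) *
          (k.factorial / G2) := by field_simp
    _ ≤ x * (2 * (B * C)) / 2 ^ (2 * a + 1) * (k : ℝ) ^ (μ - 1) * ((2 * a + 3) * k) *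
          (k : ℝ) ^ (-a) := by
        gcongr
        · nlinarith
        · rw [div_le_iff₀ hG2, Real.rpow_neg hk0.le, inv_mul_eq_div, le_div_iff₀ (by positivity)]
          exact hGk
    _ = x * (2 * (B * C)) * (2 * a + 3) / 2 ^ (2 * a + 1) * (k : ℝ) ^ (μ - a) := by
        rw [show μ - a = μ - 1 + 1 + -a by ring, Real.rpow_add hk0, Real.rpow_add_one hk0.ne']
        ring
    _ ≤ _ := by
        gcongr 1
        exact Real.rpow_le_rpow_of_nonpos hn0 hkn (by linarith)

/-- decay of the tails of the coefficients `β̃_n`: there is `C > 0` such that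
`∑_{n=N+1}^∞ |β̃_n|²/n ≤ C/N^{2ℓ-2μ+2}` whenever `2N > ℓ+1`. -/
theorem betaT_tail_decay
    (l μ x : ℝ) (hl : -(1/2 : ℝ) ≤ l) (hμ0 : 0 ≤ μ) (hμ : μ < 1/2) (hx : 0 < x)
    (f : ℝ → ℂ) (hfc : Continuous f) (hfi : Integrable f)
    (heven : ∀ t : ℝ, f (-t) = f t)
    (hsupp : ∀ t : ℝ, t ∉ Set.Icc (-x) x → f t = 0)
    (C₀ : ℝ) (hC₀ : 0 < C₀)
    (hFT : ∀ ξ : ℝ, ξ ≠ 0 → ‖fourierT f ξ‖ ≤ C₀ / |ξ| ^ (l - μ + 2)) :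
    ∃ C : ℝ, 0 < C ∧ ∀ N : ℕ, l + 1 < 2 * (N : ℝ) →
      ∑' n : ℕ, ENNReal.ofReal (‖betaT l x f (N + 1 + n)‖ ^ 2 / ((N : ℝ) + 1 + n)) ≤
        ENNReal.ofReal (C / (N : ℝ) ^ (2 * l - 2 * μ + 2)) := by
  obtain ⟨D, hD, hD'⟩ := exists_norm_betaT_le hl hμ0 hμ hx hfc hfi heven hsupp hC₀ hFT
  set s := 2 * l - 2 * μ + 2 with hs
  have hs0 : 0 < s := by linarith
  refine ⟨D ^ 2 * s⁻¹, by positivity, fun N hN => ?_⟩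
  have hN0 : (0 : ℝ) < N := by linarith
  have hN1 : 1 ≤ N := by exact_mod_cast hN0
  have hterm : ∀ n : ℕ, ‖betaT l x f (N + 1 + n)‖ ^ 2 / ((N : ℝ) + 1 + n) ≤
      D ^ 2 * ((N : ℝ) + 1 + n) ^ (-s - 1) := fun n => by
    have h1 := hD' (N + 1 + n) (by omega)
    push_cast at h1
    have hm : (0 : ℝ) < (N : ℝ) + 1 + n := by positivity
    set m := (N : ℝ) + 1 + n
    rw [div_le_iff₀ hm]
    calc ‖betaT l x f (N + 1 + n)‖ ^ 2 ≤ (D * m ^ (μ - (l + 1))) ^ 2 := by gcongr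
      _ = D ^ 2 * (m ^ (-s - 1) * m) := by
        rw [mul_pow, ← Real.rpow_add_one hm.ne', ← Real.rpow_mul_natCast hm.le, hs]
        congr 2
        push_cast
        ring
      _ = _ := by ring
  refine ENNReal.tsum_le_of_sum_range_le fun n => ?_
  rw [← ENNReal.ofReal_sum_of_nonneg fun i _ => by positivity]
  refine ENNReal.ofReal_le_ofReal ((Finset.sum_le_sum fun i _ => hterm i).trans ?_)
  rw [← Finset.mul_sum, div_eq_mul_inv, ← Real.rpow_neg hN0.le, mul_assoc]
  exact mul_le_mul_of_nonneg_left (sum_range_rpow_le hs0 hN1 n) (sq_nonneg D)
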